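/- Let G be a supersolvable group and let V be an irreducible ℂ-representation of G (a simple ℂ[G]-module) that has finite weight. Then there exist a subgroup H' ≤ G and a character χ' : H' →* ℂˣ such that the weight space V_{H'}(χ') is nonzero and the induced representation Ind_{H'}^G(χ') is Schur irreducible. -/

import Mathlib

open scoped TensorProduct

/-- A group is supersolvable if it has a finite chain of subgroups, each normal in `G`,
going from `⊤` down to `⊥`, with each successive quotient cyclic (equivalently, each
step is generated over the next one by a single element). -/
def IsSupersolvable (G : Type*) [Group G] : Prop :=
  ∃ (k : ℕ) (N : ℕ → Subgroup G),
    N 0 = ⊤ ∧ N (k + 1) = ⊥ ∧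
    (∀ i, N (i + 1) ≤ N i) ∧
    (∀ i, (N i).Normal) ∧
    (∀ i ≤ k, ∃ g : G, N i = N (i + 1) ⊔ Subgroup.closure {g})

/-- `Ind_H^G χ = ℂ[G] ⊗_{ℂ[H]} ℂ_χ`, realized as the quotient of `ℂ[G]` by the left
`ℂ[G]`-submodule generated by the elements `h - χ(h)·1` for `h ∈ H`. -/
noncomputable abbrev IndChar {G : Type*} [Group G] (H : Subgroup G) (χ : H →* ℂˣ) :=
  MonoidAlgebra ℂ G ⧸ Submodule.span (MonoidAlgebra ℂ G)
    {x : MonoidAlgebra ℂ G | ∃ h : H,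
      x = MonoidAlgebra.single (h : G) (1 : ℂ) - (χ h : ℂ) • (1 : MonoidAlgebra ℂ G)}

/-- The weight space `V_H(χ) = {v ∈ V | h • v = χ(h) v for all h ∈ H}` of a
`ℂ[G]`-module `V`. -/
def weightSpace {G : Type*} [Group G] (H : Subgroup G) (χ : H →* ℂˣ)
    (V : Type*) [AddCommGroup V] [Module ℂ V] [Module (MonoidAlgebra ℂ G) V]
    [IsScalarTower ℂ (MonoidAlgebra ℂ G) V] : Submodule ℂ V where
  carrier := {v | ∀ h : H, (MonoidAlgebra.single (h : G) (1 : ℂ)) • v = (χ h : ℂ) • v}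
  add_mem' := fun ha hb h => by rw [smul_add, ha h, hb h, smul_add]
  zero_mem' := fun h => by simp
  smul_mem' := fun c v hv h => by rw [smul_comm, hv h, smul_comm]

/-- A `ℂ[G]`-module is Schur irreducible if every `ℂ[G]`-linear endomorphism of it is
multiplication by a complex scalar. -/
def SchurIrreducible (G : Type*) [Group G] (V : Type*) [AddCommGroup V] [Module ℂ V]
    [Module (MonoidAlgebra ℂ G) V] [IsScalarTower ℂ (MonoidAlgebra ℂ G) V] : Prop :=
  ∀ f : V →ₗ[MonoidAlgebra ℂ G] V, ∃ c : ℂ, ∀ v : V, f v = c • v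

/-- A `ℂ[G]`-module has finite weight if some weight space `V_H(χ)` is nonzero and
finite-dimensional over `ℂ`. -/
def HasFiniteWeight (G : Type*) [Group G] (V : Type*) [AddCommGroup V] [Module ℂ V]
    [Module (MonoidAlgebra ℂ G) V] [IsScalarTower ℂ (MonoidAlgebra ℂ G) V] : Prop :=
  ∃ (H : Subgroup G) (χ : H →* ℂˣ),
    weightSpace H χ V ≠ ⊥ ∧ FiniteDimensional ℂ (weightSpace H χ V)

section Levels

variable {G : Type*} [Group G]

/-- A finite descending chain of normal subgroups with cyclic successive quotients. -/
structure IsCyclicChain (k : ℕ) (N : ℕ → Subgroup G) : Prop where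
  top : N 0 = ⊤
  bot : N (k + 1) = ⊥
  le : ∀ i, N (i + 1) ≤ N i
  normal : ∀ i, (N i).Normal
  cyclic : ∀ i ≤ k, ∃ g : G, N i = N (i + 1) ⊔ Subgroup.closure {g}

open Classical in
/-- The indices at which a subgroup has an element of infinite order in the corresponding
quotient of the chain. -/
noncomputable def levels (k : ℕ) (N : ℕ → Subgroup G) (H : Subgroup G) : Finset ℕ :=
  (Finset.range (k + 1)).filter fun i => ∃ y ∈ H, y ∈ N i ∧ ∀ n : ℕ, 0 < n → y ^ n ∉ N (i + 1)

theorem mem_levels {k : ℕ} {N : ℕ → Subgroup G} {H : Subgroup G} {i : ℕ} :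
    i ∈ levels k N H ↔
      i ≤ k ∧ ∃ y ∈ H, y ∈ N i ∧ ∀ n : ℕ, 0 < n → y ^ n ∉ N (i + 1) := by
  simp [levels]

theorem levels_mono {k : ℕ} {N : ℕ → Subgroup G} {H K : Subgroup G} (h : H ≤ K) :
    levels k N H ⊆ levels k N K := by
  intro i hi
  rw [mem_levels] at hi ⊢
  obtain ⟨hk, y, hy, h2⟩ := hi
  exact ⟨hk, y, h hy, h2⟩

theorem levels_subset_of_pow {k : ℕ} {N : ℕ → Subgroup G} {L H : Subgroup G}
    (h : ∀ x ∈ H, ∃ n : ℕ, 0 < n ∧ x ^ n ∈ L) : levels k N H ⊆ levels k N L := by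
  intro i hi
  rw [mem_levels] at hi ⊢
  obtain ⟨hk, y, hy, h2, h3⟩ := hi
  obtain ⟨n, hn, hnL⟩ := h y hy
  refine ⟨hk, y ^ n, hnL, pow_mem h2 n, fun m hm => ?_⟩
  rw [← pow_mul]
  exact h3 _ (Nat.mul_pos hn hm)

theorem levels_subset_of_relIndex {k : ℕ} {N : ℕ → Subgroup G} {L H : Subgroup G}
    (h : L.relIndex H ≠ 0) : levels k N H ⊆ levels k N L := by
  refine levels_subset_of_pow fun x hx => ?_
  obtain ⟨n, hn, -, hn2⟩ := Subgroup.exists_pow_mem_of_relIndex_ne_zero h hx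
  exact ⟨n, hn, hn2.1⟩

theorem levels_subset_of_conj {k : ℕ} {N : ℕ → Subgroup G} (hN : ∀ i, (N i).Normal)
    {L H : Subgroup G} (g : G) (h : ∀ x ∈ H, g * x * g⁻¹ ∈ L) :
    levels k N H ⊆ levels k N L := by
  intro i hi
  rw [mem_levels] at hi ⊢
  obtain ⟨hk, y, hy, h2, h3⟩ := hi
  refine ⟨hk, g * y * g⁻¹, h y hy, (hN i).conj_mem y h2 g, fun m hm hmem => h3 m hm ?_⟩
  rw [conj_pow] at hmem
  have := (hN (i + 1)).conj_mem _ hmem g⁻¹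
  simpa [mul_assoc] using this

theorem Subgroup.relIndex_ne_zero_of_cover {H H' : Subgroup G} {C : Set G} (hC : C.Finite)
    (h : ∀ x ∈ H', ∃ c ∈ C, c⁻¹ * x ∈ H) : H.relIndex H' ≠ 0 := by
  have := hC.to_subtype
  choose f hf hf2 using h
  have : Finite (H' ⧸ H.subgroupOf H') := by
    refine Finite.of_injective
      (fun q => (⟨f q.out q.out.2, hf _ _⟩ : C)) fun a b hab => ?_
    have hab' : f a.out a.out.2 = f b.out b.out.2 := congrArg Subtype.val hab
    rw [← a.out_eq', ← b.out_eq', QuotientGroup.eq]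
    have h1 := hf2 a.out a.out.2
    have h2 := hf2 b.out b.out.2
    rw [hab'] at h1
    have := mul_mem (inv_mem h1) h2
    rw [Subgroup.mem_subgroupOf]
    simpa [mul_assoc] using this
  exact Subgroup.index_ne_zero_of_finite

theorem Subgroup.exists_cover_of_relIndex_ne_zero {H H' : Subgroup G} (h : H.relIndex H' ≠ 0) :
    ∃ C : Set G, C.Finite ∧ C ⊆ H' ∧ ∀ x ∈ H', ∃ c ∈ C, c⁻¹ * x ∈ H := by
  have : Finite (H' ⧸ H.subgroupOf H') := @Subgroup.finite_quotient_of_finiteIndex _ _ _ ⟨h⟩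
  refine ⟨Set.range fun q : H' ⧸ H.subgroupOf H' => (q.out : G), Set.finite_range _, ?_, ?_⟩
  · rintro _ ⟨q, rfl⟩
    exact q.out.2
  · intro x hx
    refine ⟨_, ⟨((⟨x, hx⟩ : H') : H' ⧸ H.subgroupOf H'), rfl⟩, ?_⟩
    have := QuotientGroup.eq.mp
      (Quotient.out_eq' ((⟨x, hx⟩ : H') : H' ⧸ H.subgroupOf H'))
    rw [Subgroup.mem_subgroupOf] at this
    simpa using this

/-- The intersection of a subgroup with a cyclic extension of `M` is a cyclic extension of its
intersection with `M`. -/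
theorem exists_generator_mod (M : Subgroup G) [M.Normal] (g : G) (P : Subgroup G) :
    ∃ y ∈ P, y ∈ M ⊔ Subgroup.closure {g} ∧
      ∀ p ∈ P, p ∈ M ⊔ Subgroup.closure {g} → ∃ n : ℤ, ∃ q ∈ P, q ∈ M ∧ p = y ^ n * q := by
  have key : ∀ p, p ∈ M ⊔ Subgroup.closure {g} ↔ ∃ n : ℤ, (p : G ⧸ M) = (g : G ⧸ M) ^ n := by
    intro p
    rw [← SetLike.mem_coe, sup_comm, Subgroup.mul_normal, Set.mem_mul]
    constructor
    · rintro ⟨x, hx, q, hq, rfl⟩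
      rw [SetLike.mem_coe, Subgroup.mem_closure_singleton] at hx
      obtain ⟨n, rfl⟩ := hx
      exact ⟨n, by rw [← QuotientGroup.mk_zpow, QuotientGroup.eq]; simpa using hq⟩
    · rintro ⟨n, hn⟩
      rw [← QuotientGroup.mk_zpow, eq_comm, QuotientGroup.eq] at hn
      exact ⟨g ^ n, Subgroup.mem_closure_singleton.2 ⟨n, rfl⟩, _, hn, by simp⟩
  let A : AddSubgroup ℤ :=
    { carrier := {n | ∃ p ∈ P, (p : G ⧸ M) = (g : G ⧸ M) ^ n}
      zero_mem' := ⟨1, one_mem _, by simp⟩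
      add_mem' := by
        rintro a b ⟨p, hp, hp2⟩ ⟨q, hq, hq2⟩
        exact ⟨p * q, mul_mem hp hq, by rw [QuotientGroup.mk_mul, hp2, hq2, zpow_add]⟩
      neg_mem' := by
        rintro a ⟨p, hp, hp2⟩
        exact ⟨p⁻¹, inv_mem hp, by rw [QuotientGroup.mk_inv, hp2, zpow_neg]⟩ }
  obtain ⟨a, ha⟩ := Int.subgroup_cyclic A
  have haA : a ∈ A := by rw [ha]; exact AddSubgroup.subset_closure rfl
  obtain ⟨y, hy, hya⟩ := haA
  refine ⟨y, hy, (key y).2 ⟨a, hya⟩, fun p hp hpM => ?_⟩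
  obtain ⟨n, hn⟩ := (key p).1 hpM
  have hnA : n ∈ A := ⟨p, hp, hn⟩
  rw [ha, AddSubgroup.mem_closure_singleton] at hnA
  obtain ⟨m, rfl⟩ := hnA
  refine ⟨m, (y ^ m)⁻¹ * p, mul_mem (inv_mem (zpow_mem hy m)) hp, ?_, by simp⟩
  rw [← QuotientGroup.eq, QuotientGroup.mk_zpow, hya, hn, ← zpow_mul, smul_eq_mul, mul_comm]

/-- Descending induction from `k + 1`. -/
theorem descending_induction {k : ℕ} {p : ℕ → Prop} (h0 : p (k + 1))
    (hs : ∀ i ≤ k, p (i + 1) → p i) : ∀ i ≤ k + 1, p i := by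
  intro i hi
  obtain ⟨d, hd⟩ := Nat.exists_eq_add_of_le hi
  induction d generalizing i with
  | zero => rwa [show i = k + 1 by omega]
  | succ d ih => exact hs i (by omega) (ih (i + 1) (by omega) (by omega))

namespace IsCyclicChain

variable {k : ℕ} {N : ℕ → Subgroup G}

theorem exists_generator (hN : IsCyclicChain k N) {i : ℕ} (hi : i ≤ k) (P : Subgroup G) :
    ∃ y ∈ P, y ∈ N i ∧
      ∀ p ∈ P, p ∈ N i → ∃ n : ℤ, ∃ q ∈ P, q ∈ N (i + 1) ∧ p = y ^ n * q := by
  have := hN.normal (i + 1)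
  obtain ⟨g, hg⟩ := hN.cyclic i hi
  rw [hg]
  exact exists_generator_mod _ g P

theorem fg_inf (hN : IsCyclicChain k N) (P : Subgroup G) : ∀ i ≤ k + 1, (P ⊓ N i).FG := by
  refine descending_induction ?_ fun i hi ih => ?_
  · rw [hN.bot, inf_bot_eq]; exact Subgroup.FG.bot
  · obtain ⟨y, hy, hyN, h⟩ := hN.exists_generator hi P
    have : P ⊓ N i = (P ⊓ N (i + 1)) ⊔ Subgroup.closure {y} := by
      apply le_antisymm
      · intro p hp
        obtain ⟨n, q, hq, hqN, rfl⟩ := h p (Subgroup.mem_inf.1 hp).1 (Subgroup.mem_inf.1 hp).2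
        have h1 : y ∈ (P ⊓ N (i + 1)) ⊔ Subgroup.closure {y} :=
          Subgroup.mem_sup_right (Subgroup.mem_closure_singleton_self y)
        have h2 : q ∈ (P ⊓ N (i + 1)) ⊔ Subgroup.closure {y} :=
          Subgroup.mem_sup_left (Subgroup.mem_inf.2 ⟨hq, hqN⟩)
        exact mul_mem (zpow_mem h1 n) h2
      · refine sup_le (inf_le_inf_left _ (hN.le i)) ?_
        rw [Subgroup.closure_le]
        rw [Set.singleton_subset_iff]
        exact Subgroup.mem_inf.2 ⟨hy, hyN⟩
    rw [this]
    exact ih.sup (⟨{y}, by simp⟩)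

/-- Every subgroup of a polycyclic group is finitely generated. -/
theorem fg (hN : IsCyclicChain k N) (P : Subgroup G) : P.FG := by
  have := hN.fg_inf P 0 (by omega)
  rwa [hN.top, inf_top_eq] at this

theorem relIndex_inf_ne_zero (hN : IsCyclicChain k N) {H H' : Subgroup G} :
    ∀ i ≤ k + 1, (∀ j ≥ i, j ∈ levels k N H' → j ∈ levels k N H) → H ≤ H' →
      (H ⊓ N i).relIndex (H' ⊓ N i) ≠ 0 := by
  refine descending_induction ?_ fun i hi ih h hle => ?_
  · intro _ _
    rw [hN.bot, inf_bot_eq, inf_bot_eq, Subgroup.relIndex_self]; exact one_ne_zero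
  · have := hN.normal (i + 1)
    obtain ⟨C, hC, hCH, hcov⟩ := Subgroup.exists_cover_of_relIndex_ne_zero
      (ih (fun j hj => h j (by omega)) hle)
    obtain ⟨y, hy, hyN, hgen⟩ := hN.exists_generator hi H'
    obtain ⟨x, hx, hxN, d, hd, hxd⟩ : ∃ x ∈ H, x ∈ N i ∧ ∃ d : ℤ, d ≠ 0 ∧
        (x : G ⧸ N (i + 1)) = (y : G ⧸ N (i + 1)) ^ d := by
      by_cases hiH : i ∈ levels k N H'
      · obtain ⟨-, x, hx, hxN, hx3⟩ := mem_levels.1 (h i le_rfl hiH)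
        obtain ⟨n, q, hq, hqN, hxq⟩ := hgen x (hle hx) hxN
        refine ⟨x, hx, hxN, n, ?_, ?_⟩
        · rintro rfl
          exact hx3 1 one_pos (by simpa [hxq] using hqN)
        · rw [← QuotientGroup.mk_zpow, eq_comm, QuotientGroup.eq, hxq]
          simpa using hqN
      · rw [mem_levels] at hiH
        push Not at hiH
        obtain ⟨n, hn, hn2⟩ := hiH hi y hy hyN
        refine ⟨1, one_mem _, one_mem _, n, by omega, ?_⟩
        rw [zpow_natCast, ← QuotientGroup.mk_pow, QuotientGroup.eq]
        simpa using hn2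
    refine Subgroup.relIndex_ne_zero_of_cover
      (C := Set.image2 (fun (r : ℤ) c => y ^ r * c) (Set.Ico 0 |d|) C)
      ((Set.finite_Ico _ _).image2 _ hC) ?_
    intro p hpp
    obtain ⟨hp, hpN⟩ := Subgroup.mem_inf.1 hpp
    obtain ⟨n, q, hq, hqN, rfl⟩ := hgen p hp hpN
    have hz : (y ^ (n % d))⁻¹ * (y ^ n * q) * (x ^ (n / d))⁻¹ ∈ N (i + 1) := by
      rw [← QuotientGroup.eq_one_iff]
      have hq1 : (q : G ⧸ N (i + 1)) = 1 := (QuotientGroup.eq_one_iff q).2 hqN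
      simp only [QuotientGroup.mk_mul, QuotientGroup.mk_inv, QuotientGroup.mk_zpow]
      rw [hq1, hxd, mul_one, ← zpow_neg, ← zpow_mul, ← zpow_neg, ← zpow_add, ← zpow_add]
      have := Int.emod_add_mul_ediv n d
      have e : -(n % d) + n + -(d * (n / d)) = 0 := by linarith
      rw [e, zpow_zero]
    obtain ⟨c, hc, hc2⟩ := hcov _ (Subgroup.mem_inf.2
      ⟨mul_mem (mul_mem (inv_mem (zpow_mem hy (n % d))) hp)
        (inv_mem (zpow_mem (hle hx) (n / d))), hz⟩)
    refine ⟨_, ⟨n % d, ⟨Int.emod_nonneg _ hd, Int.emod_lt_abs _ hd⟩, c, hc, rfl⟩, ?_⟩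
    have h3 := mul_mem (Subgroup.mem_inf.1 hc2).1 (zpow_mem hx (n / d))
    refine Subgroup.mem_inf.2 ⟨by simpa [mul_assoc] using h3, ?_⟩
    have hcN := hN.le i (Subgroup.mem_inf.1 (hCH hc)).2
    exact mul_mem (inv_mem (mul_mem (zpow_mem hyN _) hcN)) hpN

/-- A subgroup with all the levels of an overgroup has finite index in it. -/
theorem relIndex_ne_zero (hN : IsCyclicChain k N) {H H' : Subgroup G} (hle : H ≤ H')
    (h : levels k N H' ⊆ levels k N H) : H.relIndex H' ≠ 0 := by
  have := hN.relIndex_inf_ne_zero 0 (by omega) (fun j _ hj => h hj) hle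
  rwa [hN.top, inf_top_eq, inf_top_eq] at this

/-- A subgroup containing positive powers of all elements has finite index. -/
theorem relIndex_ne_zero_of_pow (hN : IsCyclicChain k N) {H H' : Subgroup G} (hle : H ≤ H')
    (h : ∀ x ∈ H', ∃ n : ℕ, 0 < n ∧ x ^ n ∈ H) : H.relIndex H' ≠ 0 :=
  hN.relIndex_ne_zero hle (levels_subset_of_pow h)

/-- The action by conjugation on an infinite cyclic quotient of the chain is trivial or
inversion. -/
theorem conj_or (hN : IsCyclicChain k N) {i : ℕ} (hi : i ≤ k) {t : G} (ht : t ∈ N i)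
    (hinf : ∀ n : ℕ, 0 < n → t ^ n ∉ N (i + 1)) (g : G) :
    (∀ x ∈ N i, g * x * g⁻¹ * x⁻¹ ∈ N (i + 1)) ∨
      (∀ x ∈ N i, g * x * g⁻¹ * x ∈ N (i + 1)) := by
  have := hN.normal (i + 1)
  have hni := hN.normal i
  obtain ⟨c, -, hcN, hgen⟩ := hN.exists_generator hi ⊤
  have hgen' : ∀ x ∈ N i, ∃ n : ℤ, (x : G ⧸ N (i + 1)) = (c : G ⧸ N (i + 1)) ^ n := by
    intro x hx
    obtain ⟨n, q, -, hq, rfl⟩ := hgen x trivial hx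
    exact ⟨n, by rw [QuotientGroup.mk_mul, QuotientGroup.mk_zpow,
      (QuotientGroup.eq_one_iff q).2 hq, mul_one]⟩
  have hc : ∀ n : ℤ, (c : G ⧸ N (i + 1)) ^ n = 1 → n = 0 := by
    intro n hn
    by_contra h0
    obtain ⟨m, hm⟩ := hgen' t ht
    refine hinf n.natAbs (Int.natAbs_pos.2 h0) ?_
    rw [← QuotientGroup.eq_one_iff, QuotientGroup.mk_pow, hm, ← zpow_natCast, ← zpow_mul,
      mul_comm, zpow_mul]
    rcases Int.natAbs_eq n with h | h
    · rw [← h, hn, one_zpow]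
    · rw [← neg_eq_iff_eq_neg.2 h, zpow_neg, hn, inv_one, one_zpow]
  obtain ⟨a, ha⟩ := hgen' _ (hni.conj_mem c hcN g)
  obtain ⟨b, hb⟩ := hgen' _ (hni.conj_mem c hcN g⁻¹)
  have hconj : ∀ x ∈ N i, ((g * x * g⁻¹ : G) : G ⧸ N (i + 1)) = (x : G ⧸ N (i + 1)) ^ a := by
    intro x hx
    obtain ⟨n, hn⟩ := hgen' x hx
    simp only [QuotientGroup.mk_mul, QuotientGroup.mk_inv] at ha ⊢
    rw [hn, ← conj_zpow, ha, ← zpow_mul, ← zpow_mul, mul_comm]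
  have hab : b * a - 1 = 0 := by
    apply hc
    have h1 := hconj _ (hni.conj_mem c hcN g⁻¹)
    rw [hb, ← zpow_mul] at h1
    rw [zpow_sub, zpow_one, ← h1]
    simp [mul_assoc]
  have : a = 1 ∨ a = -1 := Int.isUnit_iff.1 (IsUnit.of_mul_eq_one_right b (by linarith))
  rcases this with rfl | rfl
  · left; intro x hx
    rw [← QuotientGroup.eq_one_iff, QuotientGroup.mk_mul, hconj x hx, QuotientGroup.mk_inv]
    simp
  · right; intro x hx
    rw [← QuotientGroup.eq_one_iff, QuotientGroup.mk_mul, hconj x hx]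
    simp

end IsCyclicChain

end Levels

section Isolators

variable {G : Type*} [Group G]

theorem exists_pos_of_forall_mul {α : Type*} {S : Set α} (hS : S.Finite) {C : α → ℕ → Prop}
    (h1 : ∀ p ∈ S, ∃ M, 0 < M ∧ C p M) (h2 : ∀ p M s, 0 < s → C p M → C p (M * s)) :
    ∃ M, 0 < M ∧ ∀ p ∈ S, C p M := by
  classical
  choose! f hf hfC using h1
  refine ⟨∏ p ∈ hS.toFinset, f p, Finset.prod_pos fun p hp => hf p (by simpa using hp),
    fun p hp => ?_⟩
  have hp' : p ∈ hS.toFinset := by simpa using hp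
  rw [← Finset.mul_prod_erase _ _ hp']
  refine h2 _ _ _ (Finset.prod_pos fun q hq => hf q ?_) (hfC p hp)
  simpa using Finset.mem_of_mem_erase hq

theorem mul_pow_mul_inv_mem {Q : Subgroup G} {x : G} (hx : ∀ q ∈ Q, x * q * x⁻¹ ∈ Q) {q : G}
    (hq : q ∈ Q) (n : ℕ) : (x * q) ^ n * (x ^ n)⁻¹ ∈ Q := by
  induction n with
  | zero => simp
  | succ n ih =>
    have : (x * q) ^ (n + 1) * (x ^ (n + 1))⁻¹ = x * (q * ((x * q) ^ n * (x ^ n)⁻¹)) * x⁻¹ := by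
      rw [pow_succ' (x * q), pow_succ' x, mul_inv_rev]; simp only [mul_assoc]
    rw [this]
    exact hx _ (mul_mem hq ih)

theorem exists_mul_pow_eq_pow {Q : Subgroup G} [Finite Q] {x : G}
    (hx : ∀ q ∈ Q, x * q * x⁻¹ ∈ Q) : ∃ M : ℕ, 0 < M ∧ ∀ q ∈ Q, (x * q) ^ M = x ^ M := by
  refine exists_pos_of_forall_mul (Set.toFinite (Q : Set G)) (fun q hq => ?_)
    (fun q M s _ h => by rw [pow_mul, h, pow_mul])
  obtain ⟨a, b, hab, h⟩ := Finite.exists_ne_map_eq_of_infinite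
    (fun n : ℕ => (⟨_, mul_pow_mul_inv_mem hx hq n⟩ : Q))
  wlog hlt : a < b generalizing a b
  · exact this b a hab.symm h.symm (by omega)
  have h' : (x * q) ^ a * (x ^ a)⁻¹ = (x * q) ^ b * (x ^ b)⁻¹ := congrArg Subtype.val h
  refine ⟨b - a, by omega, ?_⟩
  obtain ⟨c, rfl⟩ := Nat.exists_eq_add_of_le hlt.le
  rw [pow_add, pow_add, mul_inv_rev, mul_assoc, mul_right_inj, ← mul_assoc,
    ← mul_inv_eq_one] at h'
  have h2 : x ^ c * ((x * q) ^ c)⁻¹ = 1 := by simpa [mul_assoc] using h'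
  rw [Nat.add_sub_cancel_left]
  exact (mul_inv_eq_one.1 h2).symm

theorem exists_mul_pow_eq_pow_mul {P Q J : Subgroup G} (hJP : ∀ p ∈ P, ∀ j ∈ J, p * j * p⁻¹ ∈ J)
    (hQP : Q ≤ P) (hind : J.relIndex Q ≠ 0) {x : G} (hxP : x ∈ P)
    (hx : ∀ q ∈ Q, x * q * x⁻¹ ∈ Q) :
    ∃ M : ℕ, 0 < M ∧ ∀ q ∈ Q, ∃ j ∈ J, (x * q) ^ M = x ^ M * j := by
  have : (J.subgroupOf P).Normal := by
    refine ⟨fun j hj p => ?_⟩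
    rw [Subgroup.mem_subgroupOf] at hj ⊢
    exact hJP p p.2 j hj
  let π := QuotientGroup.mk' (J.subgroupOf P)
  have : Finite ((Q.subgroupOf P).map π) := by
    obtain ⟨C, hC, hCQ, hcov⟩ := Subgroup.exists_cover_of_relIndex_ne_zero hind
    have hfin : (π '' {c : P | (c : G) ∈ C}).Finite :=
      (hC.preimage Subtype.val_injective.injOn).image _
    refine Set.Finite.subset hfin ?_
    rintro _ ⟨q, hq, rfl⟩
    rw [SetLike.mem_coe, Subgroup.mem_subgroupOf] at hq
    obtain ⟨c, hc, hc2⟩ := hcov q hq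
    refine ⟨⟨c, hQP (hCQ hc)⟩, hc, ?_⟩
    refine QuotientGroup.eq.2 ?_
    rw [Subgroup.mem_subgroupOf]
    simpa using hc2
  obtain ⟨M, hM, h⟩ := exists_mul_pow_eq_pow (Q := (Q.subgroupOf P).map π) (x := π ⟨x, hxP⟩) (by
    rintro _ ⟨q, hq, rfl⟩
    refine ⟨⟨x, hxP⟩ * q * ⟨x, hxP⟩⁻¹, ?_, by simp⟩
    exact hx q hq)
  refine ⟨M, hM, fun q hq => ⟨(x ^ M)⁻¹ * (x * q) ^ M, ?_, by simp⟩⟩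
  have h1 := h (π ⟨q, hQP hq⟩) ⟨_, hq, rfl⟩
  rw [← map_mul, ← map_pow, ← map_pow, eq_comm] at h1
  have h2 := QuotientGroup.eq.1 h1
  rw [Subgroup.mem_subgroupOf] at h2
  simpa using h2

theorem exists_mul_pow_eq_of_normalizes {J : Subgroup G} {x j : G} (hx' : ∀ j ∈ J, x⁻¹ * j * x ∈ J)
    (hj : j ∈ J) (s : ℕ) : ∃ j' ∈ J, (x * j) ^ s = x ^ s * j' := by
  induction s with
  | zero => exact ⟨1, one_mem _, by simp⟩
  | succ s ih =>
    obtain ⟨j', hj', h⟩ := ih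
    exact ⟨x⁻¹ * j' * x * j, mul_mem (hx' _ hj') hj, by rw [pow_succ, h, pow_succ]; group⟩

namespace IsCyclicChain

variable {k : ℕ} {N : ℕ → Subgroup G}

theorem antitone (hN : IsCyclicChain k N) : Antitone N := antitone_nat_of_succ_le hN.le

theorem relIndex_inf_ne_zero_of_pow (hN : IsCyclicChain k N) {H J : Subgroup G} {i : ℕ}
    (hJ : J ≤ H ⊓ N (i + 1)) (hJi : J.relIndex (H ⊓ N (i + 1)) ≠ 0) {J' : Subgroup G}
    (hJJ' : J ≤ J') (hJ' : J' ≤ H ⊓ N i)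
    (h : i ∈ levels k N H → i ∈ levels k N J') : J'.relIndex (H ⊓ N i) ≠ 0 := by
  refine hN.relIndex_ne_zero hJ' fun j hj => ?_
  obtain ⟨hjk, y, hy, hyN, hy2⟩ := mem_levels.1 hj
  obtain ⟨hyH, hyi⟩ := Subgroup.mem_inf.1 hy
  rcases lt_trichotomy j i with hji | rfl | hji
  · exact absurd (hN.antitone hji hyi) (by simpa using hy2 1 one_pos)
  · exact h (mem_levels.2 ⟨hjk, y, hyH, hyN, hy2⟩)
  · refine levels_mono hJJ' (levels_subset_of_relIndex hJi (mem_levels.2 ⟨hjk, y, ?_, hyN, hy2⟩))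
    exact Subgroup.mem_inf.2 ⟨hyH, hN.antitone hji hyN⟩

/-- Some power of a level element `x` of `H` is carried by `p` into the cyclic extension of `J`
that it generates. -/
theorem exists_conj_pow_eq (hN : IsCyclicChain k N) {H J : Subgroup G} {i : ℕ} (hi : i ≤ k)
    (hJi : J.relIndex (H ⊓ N (i + 1)) ≠ 0)
    (hJH : ∀ p ∈ H, ∀ j ∈ J, p * j * p⁻¹ ∈ J)
    {x : G} (hx : x ∈ H) (hxN : x ∈ N i) (hinf : ∀ n : ℕ, 0 < n → x ^ n ∉ N (i + 1)) {p : G}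
    (hp : ∃ n : ℕ, 0 < n ∧ p * x ^ n * p⁻¹ ∈ H) :
    ∃ M : ℕ, 0 < M ∧ ∃ ε : ℤ, (ε = 1 ∨ ε = -1) ∧ ∃ j ∈ J, p * x ^ M * p⁻¹ = (x ^ M) ^ ε * j := by
  obtain ⟨n, hn, hpn⟩ := hp
  have := hN.normal (i + 1)
  obtain ⟨ε, hε, hq⟩ : ∃ ε : ℤ, (ε = 1 ∨ ε = -1) ∧
      ((x ^ n) ^ ε)⁻¹ * (p * x ^ n * p⁻¹) ∈ N (i + 1) := by
    rcases hN.conj_or hi hxN hinf p with h | h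
    · refine ⟨1, Or.inl rfl, ?_⟩
      have := h _ (pow_mem hxN n)
      rw [(hN.normal (i + 1)).mem_comm_iff] at this
      simpa using this
    · refine ⟨-1, Or.inr rfl, ?_⟩
      have := h _ (pow_mem hxN n)
      rw [(hN.normal (i + 1)).mem_comm_iff] at this
      simpa using this
  have hxε : (x ^ n) ^ ε ∈ H := zpow_mem (pow_mem hx n) ε
  obtain ⟨M, hM, h⟩ := exists_mul_pow_eq_pow_mul hJH inf_le_left hJi hxε (fun q hq =>
    Subgroup.mem_inf.2 ⟨mul_mem (mul_mem hxε (Subgroup.mem_inf.1 hq).1) (inv_mem hxε),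
      (hN.normal (i + 1)).conj_mem _ (Subgroup.mem_inf.1 hq).2 _⟩)
  obtain ⟨j, hj, hj2⟩ := h _ (Subgroup.mem_inf.2 ⟨mul_mem (inv_mem hxε) hpn, hq⟩)
  refine ⟨n * M, Nat.mul_pos hn hM, ε, hε, j, hj, ?_⟩
  rw [mul_inv_cancel_left, conj_pow, ← pow_mul] at hj2
  rw [hj2, ← zpow_natCast ((x ^ n) ^ ε), ← zpow_mul, mul_comm ε, zpow_mul, zpow_natCast, ← pow_mul]

/-- Conjugating by the generators of `P` and their inverses is enough to normalize. -/
theorem conj_mem_of_generators {P B : Subgroup G} {S : Set G} (hS : Subgroup.closure S = P)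
    (h1 : ∀ p ∈ S, ∀ b ∈ B, p * b * p⁻¹ ∈ B) (h2 : ∀ p ∈ S, ∀ b ∈ B, p⁻¹ * b * p ∈ B) :
    ∀ p ∈ P, ∀ b ∈ B, p * b * p⁻¹ ∈ B := by
  suffices h : ∀ p ∈ P, (∀ b ∈ B, p * b * p⁻¹ ∈ B) ∧ ∀ b ∈ B, p⁻¹ * b * p ∈ B from
    fun p hp => (h p hp).1
  rw [← hS]
  intro p hp
  induction hp using Subgroup.closure_induction with
  | mem p hp => exact ⟨h1 p hp, h2 p hp⟩
  | one => simp
  | mul p q _ _ hp hq =>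
    refine ⟨fun b hb => ?_, fun b hb => ?_⟩
    · simpa [mul_assoc] using hp.1 _ (hq.1 b hb)
    · simpa [mul_assoc] using hq.2 _ (hp.2 b hb)
  | inv p _ hp => exact ⟨fun b hb => by simpa using hp.2 b hb, fun b hb => by simpa using hp.1 b hb⟩

theorem exists_isolated_step (hN : IsCyclicChain k N) {P H J : Subgroup G} {i : ℕ} (hi : i ≤ k)
    (hHP : H ≤ P) (hcomm : ∀ p ∈ P, ∀ x ∈ H, ∃ n : ℕ, 0 < n ∧ p * x ^ n * p⁻¹ ∈ H)
    (hJ : J ≤ H ⊓ N (i + 1)) (hJi : J.relIndex (H ⊓ N (i + 1)) ≠ 0)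
    (hJP : ∀ p ∈ P, ∀ j ∈ J, p * j * p⁻¹ ∈ J) :
    ∃ J' ≤ H ⊓ N i, J'.relIndex (H ⊓ N i) ≠ 0 ∧ ∀ p ∈ P, ∀ j ∈ J', p * j * p⁻¹ ∈ J' := by
  by_cases hiH : i ∈ levels k N H
  swap
  · exact ⟨J, hJ.trans (inf_le_inf_left _ (hN.le i)), hN.relIndex_inf_ne_zero_of_pow hJ hJi le_rfl
      (hJ.trans (inf_le_inf_left _ (hN.le i))) (fun h => absurd h hiH), hJP⟩
  obtain ⟨-, x, hx, hxN, hinf⟩ := mem_levels.1 hiH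
  have hJP' : ∀ p ∈ P, ∀ j ∈ J, p⁻¹ * j * p ∈ J := fun p hp j hj => by
    simpa using hJP _ (inv_mem hp) j hj
  obtain ⟨S, hSP⟩ := hN.fg P
  let C : G → ℕ → Prop := fun p M => p ∈ P →
    ∃ ε : ℤ, ∃ j ∈ J, p * x ^ M * p⁻¹ = (x ^ M) ^ ε * j
  have hC1 : ∀ p, ∃ M, 0 < M ∧ C p M := by
    intro p
    by_cases hp : p ∈ P
    · obtain ⟨M, hM, ε, -, h⟩ := hN.exists_conj_pow_eq hi hJi
        (fun p hp => hJP p (hHP hp)) hx hxN hinf (hcomm p hp x hx)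
      exact ⟨M, hM, fun _ => ⟨ε, h⟩⟩
    · exact ⟨1, one_pos, fun h => absurd h hp⟩
  have hC2 : ∀ p M s, 0 < s → C p M → C p (M * s) := by
    intro p M s _ h hp
    obtain ⟨ε, j, hj, h⟩ := h hp
    have hxε : (x ^ M) ^ ε ∈ P := zpow_mem (pow_mem (hHP hx) M) ε
    obtain ⟨j', hj', h'⟩ := exists_mul_pow_eq_of_normalizes (hJP' _ hxε) hj s
    refine ⟨ε, j', hj', ?_⟩
    rw [← h, conj_pow, ← pow_mul] at h'
    rw [h', ← zpow_natCast ((x ^ M) ^ ε), ← zpow_mul, mul_comm ε, zpow_mul, zpow_natCast, ← pow_mul]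
  obtain ⟨M, hM, hCM⟩ := exists_pos_of_forall_mul (S := (S : Set G) ∪ (fun p => p⁻¹) '' S)
    (S.finite_toSet.union (S.finite_toSet.image _)) (fun p _ => hC1 p) hC2
  have hSsub : (S : Set G) ⊆ P := by rw [← hSP]; exact Subgroup.subset_closure
  let J' := J ⊔ Subgroup.closure {x ^ M}
  have hxJ' : x ^ M ∈ J' := Subgroup.mem_sup_right (Subgroup.mem_closure_singleton_self _)
  have hJ'le : J' ≤ H ⊓ N i := by
    refine sup_le (hJ.trans (inf_le_inf_left _ (hN.le i))) ?_
    rw [Subgroup.closure_le, Set.singleton_subset_iff]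
    exact Subgroup.mem_inf.2 ⟨pow_mem hx M, pow_mem hxN M⟩
  have hconj : ∀ p ∈ P, C p M → ∀ b ∈ J', p * b * p⁻¹ ∈ J' := by
    intro p hp hCp
    have : J' ≤ J'.comap (MulAut.conj p).toMonoidHom := by
      refine sup_le (fun j hj => ?_) ?_
      · exact Subgroup.mem_sup_left (hJP p hp j hj)
      · rw [Subgroup.closure_le, Set.singleton_subset_iff]
        obtain ⟨ε, j, hj, h⟩ := hCp hp
        change p * x ^ M * p⁻¹ ∈ J'
        rw [h]
        exact mul_mem (zpow_mem hxJ' ε) (Subgroup.mem_sup_left hj)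
    exact fun b hb => this hb
  refine ⟨J', hJ'le, hN.relIndex_inf_ne_zero_of_pow hJ hJi le_sup_left hJ'le fun _ =>
    mem_levels.2 ⟨hi, x ^ M, hxJ', pow_mem hxN M, fun n hn => ?_⟩, ?_⟩
  · rw [← pow_mul]; exact hinf _ (Nat.mul_pos hM hn)
  · refine conj_mem_of_generators hSP (fun p hp => hconj p (hSsub hp) (hCM p (Or.inl hp)))
      fun p hp => ?_
    have := hconj p⁻¹ (inv_mem (hSsub hp)) (hCM _ (Or.inr ⟨p, hp, rfl⟩))
    simpa using this

/-- A subgroup commensurated by `P` contains a subgroup of finite index normalized by `P`. -/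
theorem exists_isolated (hN : IsCyclicChain k N) {P H : Subgroup G}
    (hHP : H ≤ P) (hcomm : ∀ p ∈ P, ∀ x ∈ H, ∃ n : ℕ, 0 < n ∧ p * x ^ n * p⁻¹ ∈ H) :
    ∃ J ≤ H, J.relIndex H ≠ 0 ∧ ∀ p ∈ P, ∀ j ∈ J, p * j * p⁻¹ ∈ J := by
  have : ∀ i ≤ k + 1, ∃ J ≤ H ⊓ N i, J.relIndex (H ⊓ N i) ≠ 0 ∧
      ∀ p ∈ P, ∀ j ∈ J, p * j * p⁻¹ ∈ J := by
    refine descending_induction ⟨⊥, bot_le, ?_, ?_⟩ fun i hi ⟨J, h1, h2, h3⟩ =>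
      hN.exists_isolated_step hi hHP hcomm h1 h2 h3
    · rw [hN.bot, inf_bot_eq, Subgroup.relIndex_self]; exact one_ne_zero
    · intro p _ j hj
      rw [Subgroup.mem_bot] at hj ⊢
      simp [hj]
  simpa [hN.top] using this 0 (by omega)

/-- The elements acting trivially by conjugation on all quotients of the chain. -/
def fixer (hN : IsCyclicChain k N) : Subgroup G where
  carrier := {g | ∀ i ≤ k, ∀ n ∈ N i, g * n * g⁻¹ * n⁻¹ ∈ N (i + 1)}
  one_mem' := fun i _ n _ => by simp
  mul_mem' := by
    intro a b ha hb i hi n hn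
    have := mul_mem (ha i hi _ ((hN.normal i).conj_mem n hn b)) (hb i hi n hn)
    simpa [mul_assoc] using this
  inv_mem' := by
    intro a ha i hi n hn
    have h1 := ha i hi _ ((hN.normal i).conj_mem n hn a⁻¹)
    have := inv_mem h1
    simpa [mul_assoc] using this

theorem mem_fixer (hN : IsCyclicChain k N) {g : G} :
    g ∈ hN.fixer ↔ ∀ i ≤ k, ∀ n ∈ N i, g * n * g⁻¹ * n⁻¹ ∈ N (i + 1) := Iff.rfl

theorem fixer_normal (hN : IsCyclicChain k N) : hN.fixer.Normal := by
  refine ⟨fun g hg h i hi n hn => ?_⟩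
  have h1 := (hN.normal (i + 1)).conj_mem _ (hg i hi _ ((hN.normal i).conj_mem n hn h⁻¹)) h
  simpa [mul_assoc] using h1

theorem exists_pow_fix_level (hN : IsCyclicChain k N) {i : ℕ} (hi : i ≤ k) :
    ∃ m : ℕ, 0 < m ∧ ∀ g, ∀ n ∈ N i, g ^ m * n * (g ^ m)⁻¹ * n⁻¹ ∈ N (i + 1) := by
  have := hN.normal (i + 1)
  have hni := hN.normal i
  by_cases hinf : ∃ t ∈ N i, ∀ n : ℕ, 0 < n → t ^ n ∉ N (i + 1)
  · obtain ⟨t, ht, hinf⟩ := hinf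
    refine ⟨2, two_pos, fun g n hn => ?_⟩
    rcases hN.conj_or hi ht hinf g with h | h
    · have := mul_mem (h _ (hni.conj_mem n hn g)) (h n hn)
      simpa [mul_assoc, pow_two] using this
    · have := mul_mem (h _ (hni.conj_mem n hn g)) (inv_mem ((hN.normal (i + 1)).mem_comm (h n hn)))
      simpa [mul_assoc, pow_two] using this
  · push Not at hinf
    let A := (N i).map (QuotientGroup.mk' (N (i + 1)))
    have hA : A.Normal := hni.map _ (QuotientGroup.mk'_surjective _)
    have : Finite A := by
      obtain ⟨y, -, hy, hgen⟩ := hN.exists_generator hi ⊤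
      obtain ⟨n, hn, hyn⟩ := hinf y hy
      refine Set.Finite.subset ((Set.finite_Ico (0 : ℤ) n).image
        fun j => QuotientGroup.mk' (N (i + 1)) y ^ j) ?_
      rintro _ ⟨x, hx, rfl⟩
      obtain ⟨m, q, -, hq, rfl⟩ := hgen x trivial hx
      refine ⟨m % n, ⟨Int.emod_nonneg _ (by omega), Int.emod_lt_of_pos _ (by omega)⟩, ?_⟩
      have h1 : QuotientGroup.mk' (N (i + 1)) q = 1 := (QuotientGroup.eq_one_iff q).2 hq
      have h2 : QuotientGroup.mk' (N (i + 1)) y ^ (n : ℤ) = 1 := by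
        rw [zpow_natCast, ← map_pow]; exact (QuotientGroup.eq_one_iff _).2 hyn
      dsimp only
      rw [map_mul, h1, mul_one, map_zpow]
      conv_rhs => rw [← Int.emod_add_mul_ediv m n, zpow_add, zpow_mul, h2, one_zpow, mul_one]
    refine ⟨Nat.card (MulAut A), Nat.card_pos, fun g n hn => ?_⟩
    have h1 : MulAut.conjNormal (H := A) (QuotientGroup.mk' (N (i + 1)) g) ^
        Nat.card (MulAut A) = 1 := pow_card_eq_one'
    rw [← map_pow, ← map_pow] at h1
    have h2 := congrArg (fun f : MulAut A => ((f ⟨_, n, hn, rfl⟩ : A) : G ⧸ N (i + 1))) h1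
    simp only [MulAut.conjNormal_apply, MulAut.one_apply] at h2
    rw [← map_mul, ← map_inv, ← map_mul] at h2
    rw [← QuotientGroup.eq_one_iff, QuotientGroup.mk_mul, QuotientGroup.mk_inv]
    exact mul_inv_eq_one.2 h2

theorem exists_pow_mem_fixer (hN : IsCyclicChain k N) :
    ∃ m : ℕ, 0 < m ∧ ∀ g : G, g ^ m ∈ hN.fixer := by
  obtain ⟨m, hm, h⟩ := exists_pos_of_forall_mul (S := Set.Iic k) (Set.finite_Iic k)
    (C := fun i m => ∀ g, ∀ n ∈ N i, g ^ m * n * (g ^ m)⁻¹ * n⁻¹ ∈ N (i + 1))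
    (fun i hi => hN.exists_pow_fix_level hi) (fun i M s _ h g n hn => by
      rw [mul_comm, pow_mul]; exact h _ n hn)
  exact ⟨m, hm, fun g i hi n hn => h i hi g n hn⟩

/-- Given a function `χ` on `K₀` which is locally invariant under `P`, there is a
subgroup of finite index in `K₀` normalized by `P` on which `χ` is invariant. -/
theorem exists_normalized_subgroup (hN : IsCyclicChain k N) {P K₀ : Subgroup G} {χ : G → ℂ}
    (hK₀P : K₀ ≤ P)
    (hP : ∀ p ∈ P, ∃ L ≤ K₀, L.relIndex K₀ ≠ 0 ∧ ∀ l ∈ L, p⁻¹ * l * p ∈ K₀ ∧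
      χ (p⁻¹ * l * p) = χ l) :
    ∃ K ≤ K₀, K.relIndex K₀ ≠ 0 ∧ K ≤ hN.fixer ∧ (∀ p ∈ P, ∀ x ∈ K, p * x * p⁻¹ ∈ K) ∧
      ∀ p ∈ P, ∀ x ∈ K, χ (p⁻¹ * x * p) = χ x := by
  obtain ⟨J, hJK₀, hJi, hJP⟩ := hN.exists_isolated hK₀P (fun p hp x hx => by
    obtain ⟨L, -, hLi, hL⟩ := hP p⁻¹ (inv_mem hp)
    obtain ⟨n, hn, -, hxn⟩ := Subgroup.exists_pow_mem_of_relIndex_ne_zero hLi hx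
    exact ⟨n, hn, by simpa using (hL _ (Subgroup.mem_inf.1 hxn).1).1⟩)
  obtain ⟨S, hSP⟩ := hN.fg P
  have hSsub : (S : Set G) ⊆ P := by rw [← hSP]; exact Subgroup.subset_closure
  obtain ⟨m₀, hm₀, hm₀F⟩ := hN.exists_pow_mem_fixer
  choose! L hLK hLi hL using hP
  obtain ⟨m, hm, hmS⟩ := exists_pos_of_forall_mul (S := (S : Set G)) S.finite_toSet
    (C := fun p m => ∀ x ∈ K₀, x ^ m ∈ L p)
    (fun p hp => ⟨((L p).relIndex K₀).factorial, Nat.factorial_pos _, fun x hx =>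
      (Subgroup.mem_inf.1 (Subgroup.pow_mem_of_relIndex_ne_zero_of_dvd (hLi p (hSsub hp)) hx
        fun m hm hm' => Nat.dvd_factorial hm hm')).1⟩)
    (fun p M s _ h x hx => by rw [pow_mul]; exact pow_mem (h x hx) s)
  let K := Subgroup.closure ((fun x => x ^ (m * m₀)) '' (J : Set G))
  have hKJ : K ≤ J := by
    rw [Subgroup.closure_le]
    rintro _ ⟨x, hx, rfl⟩
    exact pow_mem hx _
  have hKL : ∀ p ∈ S, K ≤ L p := by
    intro p hp
    rw [Subgroup.closure_le]
    rintro _ ⟨x, hx, rfl⟩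
    dsimp only
    rw [pow_mul]
    exact pow_mem (hmS p hp x (hJK₀ hx)) _
  have hKP : ∀ p ∈ P, ∀ x ∈ K, p * x * p⁻¹ ∈ K := by
    intro p hp
    have : K ≤ K.comap (MulAut.conj p).toMonoidHom := by
      rw [Subgroup.closure_le]
      rintro _ ⟨x, hx, rfl⟩
      refine Subgroup.subset_closure ⟨p * x * p⁻¹, hJP p hp x hx, ?_⟩
      simp [conj_pow]
    exact fun x hx => this hx
  have hKP' : ∀ p ∈ P, ∀ x ∈ K, p⁻¹ * x * p ∈ K := fun p hp x hx => by
    simpa using hKP _ (inv_mem hp) x hx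
  have hKi : K.relIndex J ≠ 0 := hN.relIndex_ne_zero_of_pow hKJ fun x hx =>
    ⟨m * m₀, Nat.mul_pos hm hm₀, Subgroup.subset_closure ⟨x, hx, rfl⟩⟩
  refine ⟨K, hKJ.trans hJK₀, Subgroup.relIndex_ne_zero_trans hKi hJi, ?_, hKP, ?_⟩
  · rw [Subgroup.closure_le]
    rintro _ ⟨x, hx, rfl⟩
    dsimp only
    rw [mul_comm, pow_mul]
    exact pow_mem (hm₀F x) _
  · suffices h : ∀ p ∈ P, p ∈ P ∧ ∀ x ∈ K, χ (p⁻¹ * x * p) = χ x from fun p hp => (h p hp).2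
    conv => enter [p]; rw [← hSP]
    intro p hp
    induction hp using Subgroup.closure_induction with
    | mem p hp => exact ⟨Subgroup.subset_closure hp,
        fun x hx => (hL p (hSsub hp) x (hKL p hp hx)).2⟩
    | one => exact ⟨one_mem _, by simp⟩
    | mul p q _ _ hp hq =>
      refine ⟨mul_mem hp.1 hq.1, fun x hx => ?_⟩
      have h2 := hq.2 _ (hKP' p (hSP ▸ hp.1) x hx)
      rw [hp.2 x hx] at h2
      simpa [mul_assoc] using h2
    | inv p _ hp =>
      refine ⟨inv_mem hp.1, fun x hx => ?_⟩
      have h2 := hp.2 _ (hKP p (hSP ▸ hp.1) x hx)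
      simpa [mul_assoc] using h2.symm

end IsCyclicChain

end Isolators

section WeightVectors

variable {G : Type*} [Group G] {V : Type*} [AddCommGroup V] [Module ℂ V]

theorem apply_apply_eq (ρ : G →* Module.End ℂ V) (a b : G) (v : V) :
    ρ a (ρ b v) = ρ (a * b) v := by
  rw [map_mul]; rfl

@[simp] theorem apply_inv_apply (ρ : G →* Module.End ℂ V) (a : G) (v : V) :
    ρ a (ρ a⁻¹ v) = v := by
  rw [apply_apply_eq, mul_inv_cancel, map_one]; rfl

@[simp] theorem inv_apply_apply (ρ : G →* Module.End ℂ V) (a : G) (v : V) :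
    ρ a⁻¹ (ρ a v) = v := by
  rw [apply_apply_eq, inv_mul_cancel, map_one]; rfl

theorem apply_ne_zero (ρ : G →* Module.End ℂ V) (a : G) {v : V} (hv : v ≠ 0) : ρ a v ≠ 0 := by
  intro h
  apply hv
  rw [← inv_apply_apply ρ a v, h, map_zero]

/-- The stabilizer of the line spanned by a vector. -/
def lineStab (ρ : G →* Module.End ℂ V) (v : V) : Subgroup G where
  carrier := {g | ∃ c : ℂˣ, ρ g v = (c : ℂ) • v}
  one_mem' := ⟨1, by simp⟩
  mul_mem' := by
    rintro a b ⟨c, hc⟩ ⟨d, hd⟩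
    exact ⟨d * c, by rw [← apply_apply_eq, hd, map_smul, hc, smul_smul, Units.val_mul]⟩
  inv_mem' := by
    rintro a ⟨c, hc⟩
    refine ⟨c⁻¹, ?_⟩
    have := congrArg (fun v => ((c⁻¹ : ℂˣ) : ℂ) • ρ a⁻¹ v) hc
    simp only [map_smul, smul_smul, inv_apply_apply] at this
    simpa using this.symm

theorem mem_lineStab_of_smul {ρ : G →* Module.End ℂ V} {v : V} {g : G} {c : ℂ}
    (h : ρ g v = c • v) : g ∈ lineStab ρ v := by
  by_cases hc : c = 0
  · have hv : v = 0 := by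
      rw [hc, zero_smul] at h
      rw [← inv_apply_apply ρ g v, h, map_zero]
    exact ⟨1, by simp [hv]⟩
  · exact ⟨Units.mk0 c hc, h⟩

/-- The vectors on which `K` acts through the function `χ`. -/
def weightVectors (ρ : G →* Module.End ℂ V) (K : Subgroup G) (χ : G → ℂ) : Submodule ℂ V where
  carrier := {v | ∀ g ∈ K, ρ g v = χ g • v}
  add_mem' := fun ha hb g hg => by rw [map_add, ha g hg, hb g hg, smul_add]
  zero_mem' := fun g _ => by simp
  smul_mem' := fun c v hv g hg => by rw [map_smul, hv g hg, smul_comm]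

theorem mem_weightVectors {ρ : G →* Module.End ℂ V} {K : Subgroup G} {χ : G → ℂ} {v : V} :
    v ∈ weightVectors ρ K χ ↔ ∀ g ∈ K, ρ g v = χ g • v := Iff.rfl

theorem weightVectors_anti (ρ : G →* Module.End ℂ V) {K L : Subgroup G} (h : L ≤ K) (χ : G → ℂ) :
    weightVectors ρ K χ ≤ weightVectors ρ L χ := fun _ hv g hg => hv g (h hg)

theorem le_lineStab {ρ : G →* Module.End ℂ V} {K : Subgroup G} {χ : G → ℂ} {v : V}
    (hv : v ∈ weightVectors ρ K χ) : K ≤ lineStab ρ v :=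
  fun g hg => mem_lineStab_of_smul (hv g hg)

theorem weight_eq {v : V} (hv : v ≠ 0) {a b : ℂ} (h : a • v = b • v) : a = b :=
  smul_left_injective ℂ hv h

/-- A weight `(K, χ)` with as many levels as possible, together with its commensurating
stabilizer `P`. -/
structure MaximalWeight (ρ : G →* Module.End ℂ V) {k : ℕ} {N : ℕ → Subgroup G}
    (hN : IsCyclicChain k N) (P K : Subgroup G) (χ : G → ℂ) : Prop where
  le : K ≤ P
  le_fixer : K ≤ hN.fixer
  conj_mem : ∀ p ∈ P, ∀ x ∈ K, p * x * p⁻¹ ∈ K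
  conj_eq : ∀ p ∈ P, ∀ x ∈ K, χ (p⁻¹ * x * p) = χ x
  nonzero : ∃ v ≠ 0, v ∈ weightVectors ρ K χ
  card_le : ∀ v ≠ 0, (levels k N (lineStab ρ v)).card ≤ (levels k N K).card
  mem_of_conj : ∀ g : G, (∃ L ≤ K, L.relIndex K ≠ 0 ∧ ∀ l ∈ L, g⁻¹ * l * g ∈ K ∧
      χ (g⁻¹ * l * g) = χ l) → g ∈ P

namespace IsCyclicChain

variable {k : ℕ} {N : ℕ → Subgroup G}

/-- The elements under which `χ` is locally invariant. -/
def localStab (hN : IsCyclicChain k N) (K : Subgroup G) (χ : G → ℂ) : Subgroup G where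
  carrier := {g | ∃ L ≤ K, L.relIndex K ≠ 0 ∧ ∀ l ∈ L, g⁻¹ * l * g ∈ K ∧ χ (g⁻¹ * l * g) = χ l}
  one_mem' := ⟨K, le_rfl, by simp, fun l hl => by simpa using hl⟩
  mul_mem' := by
    rintro a b ⟨L, hLK, hLi, hL⟩ ⟨M, hMK, hMi, hM⟩
    refine ⟨L ⊓ M.comap (MulAut.conj a⁻¹).toMonoidHom, inf_le_left.trans hLK,
      hN.relIndex_ne_zero_of_pow (inf_le_left.trans hLK) fun x hx => ?_, fun l hl => ?_⟩
    · obtain ⟨n, hn, -, hxn⟩ := Subgroup.exists_pow_mem_of_relIndex_ne_zero hLi hx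
      have hxL := (Subgroup.mem_inf.1 hxn).1
      obtain ⟨m, hm, -, hxm⟩ := Subgroup.exists_pow_mem_of_relIndex_ne_zero hMi (hL _ hxL).1
      refine ⟨n * m, Nat.mul_pos hn hm, Subgroup.mem_inf.2 ⟨?_, ?_⟩⟩
      · rw [pow_mul]; exact pow_mem hxL m
      · rw [pow_mul]
        have := (Subgroup.mem_inf.1 hxm).1
        have e : (a⁻¹ * x ^ n * a) ^ m = a⁻¹ * (x ^ n) ^ m * a := by
          simpa using conj_pow (i := m) (a := a⁻¹) (b := x ^ n)
        rw [e] at this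
        rw [Subgroup.mem_comap]
        simpa using this
    · obtain ⟨hl1, hl2⟩ := Subgroup.mem_inf.1 hl
      have hl2 : a⁻¹ * l * a ∈ M := by simpa using hl2
      have h1 := hL l hl1
      have h2 := hM _ hl2
      rw [h1.2] at h2
      simpa [mul_assoc] using h2
  inv_mem' := by
    rintro a ⟨L, hLK, hLi, hL⟩
    have hle : L.map (MulAut.conj a⁻¹).toMonoidHom ≤ K := by
      rintro _ ⟨l, hl, rfl⟩
      simpa using (hL l hl).1
    refine ⟨L.map (MulAut.conj a⁻¹).toMonoidHom, hle, hN.relIndex_ne_zero hle ?_, ?_⟩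
    · refine (levels_subset_of_relIndex hLi).trans (levels_subset_of_conj hN.normal a⁻¹ ?_)
      intro x hx
      exact ⟨x, hx, by simp⟩
    · rintro _ ⟨l, hl, rfl⟩
      have := hL l hl
      refine ⟨by simpa [mul_assoc] using hLK hl, ?_⟩
      simpa [mul_assoc] using this.2.symm

/-- Every nonzero representation has a maximal weight. -/
theorem exists_maximalWeight (hN : IsCyclicChain k N) (ρ : G →* Module.End ℂ V)
    (hV : ∃ v : V, v ≠ 0) : ∃ P K χ, MaximalWeight ρ hN P K χ := by
  have hbdd : ∃ n, ∀ v : V, v ≠ 0 → (levels k N (lineStab ρ v)).card ≤ n :=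
    ⟨k + 1, fun v _ => by
      have : levels k N (lineStab ρ v) ⊆ Finset.range (k + 1) := fun i hi => by
        simpa [Nat.lt_succ_iff] using (mem_levels.1 hi).1
      simpa using Finset.card_le_card this⟩
  obtain ⟨v₀, hv₀, hmax⟩ : ∃ v₀ : V, v₀ ≠ 0 ∧ ∀ v : V, v ≠ 0 →
      (levels k N (lineStab ρ v)).card ≤ (levels k N (lineStab ρ v₀)).card := by
    classical
    by_contra! h
    obtain ⟨n, hn⟩ := hbdd
    obtain ⟨v, hv⟩ := hV
    have : ∀ m : ℕ, ∃ v : V, v ≠ 0 ∧ m ≤ (levels k N (lineStab ρ v)).card := by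
      intro m
      induction m with
      | zero => exact ⟨v, hv, Nat.zero_le _⟩
      | succ m ih =>
        obtain ⟨v, hv, hm⟩ := ih
        obtain ⟨w, hw, hwm⟩ := h v hv
        exact ⟨w, hw, by omega⟩
    obtain ⟨w, hw, hwn⟩ := this (n + 1)
    have := hn w hw
    omega
  set K₀ := lineStab ρ v₀ with hK₀
  have hχ : ∀ g, ∃ c : ℂ, g ∈ K₀ → ρ g v₀ = c • v₀ := by
    intro g
    by_cases hg : g ∈ K₀
    · obtain ⟨c, hc⟩ := hg
      exact ⟨c, fun _ => hc⟩
    · exact ⟨0, fun h => absurd h hg⟩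
  choose χ hχ using hχ
  have hK₀P : K₀ ≤ hN.localStab K₀ χ := by
    intro g hg
    refine ⟨K₀, le_rfl, by simp, fun l hl => ?_⟩
    have hmem : g⁻¹ * l * g ∈ K₀ := mul_mem (mul_mem (inv_mem hg) hl) hg
    refine ⟨hmem, ?_⟩
    have h1 : ρ g (ρ (g⁻¹ * l * g) v₀) = ρ l (ρ g v₀) := by
      rw [apply_apply_eq, apply_apply_eq]
      congr 2
      group
    rw [hχ _ hmem, hχ _ hg, map_smul, map_smul, hχ _ hg, hχ _ hl, smul_smul, smul_smul] at h1
    have h2 := weight_eq hv₀ h1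
    have h3 : χ g ≠ 0 := by
      intro h0
      have := hχ g hg
      rw [h0, zero_smul] at this
      exact apply_ne_zero ρ g hv₀ this
    rw [mul_comm] at h2
    exact mul_left_cancel₀ h3 h2
  obtain ⟨K, hKK₀, hKi, hKF, hKP, hKχ⟩ := hN.exists_normalized_subgroup hK₀P fun p hp => hp
  have hlev := levels_subset_of_relIndex (k := k) (N := N) hKi
  refine ⟨hN.localStab K₀ χ, K, χ, hKK₀.trans hK₀P, hKF, hKP, hKχ,
    ⟨v₀, hv₀, fun g hg => hχ g (hKK₀ hg)⟩,
    fun v hv => (hmax v hv).trans (Finset.card_le_card hlev), ?_⟩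
  rintro g ⟨L, hLK, hLi, hL⟩
  exact ⟨L, hLK.trans hKK₀, Subgroup.relIndex_ne_zero_trans hLi hKi,
    fun l hl => ⟨hKK₀ (hL l hl).1, (hL l hl).2⟩⟩

end IsCyclicChain

namespace MaximalWeight

variable {k : ℕ} {N : ℕ → Subgroup G} {hN : IsCyclicChain k N} {ρ : G →* Module.End ℂ V}
  {P K : Subgroup G} {χ : G → ℂ}

theorem conj_mem' (h : MaximalWeight ρ hN P K χ) : ∀ p ∈ P, ∀ x ∈ K, p⁻¹ * x * p ∈ K :=
  fun p hp x hx => by simpa using h.conj_mem _ (inv_mem hp) x hx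

theorem apply_mem (h : MaximalWeight ρ hN P K χ) {p : G} (hp : p ∈ P) {w : V}
    (hw : w ∈ weightVectors ρ K χ) : ρ p w ∈ weightVectors ρ K χ := by
  intro x hx
  have : ρ x (ρ p w) = ρ p (ρ (p⁻¹ * x * p) w) := by
    rw [apply_apply_eq, apply_apply_eq]; congr 2; group
  rw [this, hw _ (h.conj_mem' p hp x hx), map_smul, h.conj_eq p hp x hx]

theorem levels_lineStab (h : MaximalWeight ρ hN P K χ) {L : Subgroup G} {w : V} (hw : w ≠ 0)
    (hLw : L ≤ lineStab ρ w) (hL : (levels k N K).card ≤ (levels k N L).card) :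
    levels k N (lineStab ρ w) = levels k N L :=
  (Finset.eq_of_subset_of_card_le (levels_mono hLw) ((h.card_le w hw).trans hL)).symm

theorem relIndex_lineStab_ne_zero (h : MaximalWeight ρ hN P K χ) {L : Subgroup G} {w : V}
    (hw : w ≠ 0) (hLw : L ≤ lineStab ρ w) (hL : (levels k N K).card ≤ (levels k N L).card) :
    L.relIndex (lineStab ρ w) ≠ 0 :=
  hN.relIndex_ne_zero hLw (h.levels_lineStab hw hLw hL).subset

/-- A vector cannot have both the weight `(K, χ)`, up to finite index, and a conjugate of it by an
element outside `P`. -/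
theorem mem_of_common_weight (h : MaximalWeight ρ hN P K χ) {L : Subgroup G} (hLK : L ≤ K)
    (hLi : L.relIndex K ≠ 0) {w : V} (hw : w ≠ 0) (hwL : w ∈ weightVectors ρ L χ) {g : G}
    (hwg : ρ g⁻¹ w ∈ weightVectors ρ K χ) : g ∈ P := by
  have h1 := h.relIndex_lineStab_ne_zero hw (le_lineStab hwL)
    (Finset.card_le_card (levels_subset_of_relIndex hLi))
  have hact : ∀ x ∈ K, ρ (g * x * g⁻¹) w = χ x • w := by
    intro x hx
    rw [mul_assoc, ← apply_apply_eq, ← apply_apply_eq, hwg x hx, map_smul, apply_inv_apply]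
  have h2 : (K.map (MulAut.conj g).toMonoidHom).relIndex (lineStab ρ w) ≠ 0 := by
    refine h.relIndex_lineStab_ne_zero hw ?_ (Finset.card_le_card
      (levels_subset_of_conj hN.normal g fun x hx => ⟨x, hx, by simp⟩))
    rintro _ ⟨x, hx, rfl⟩
    exact mem_lineStab_of_smul (hact x hx)
  have h3 := Subgroup.relIndex_inf_ne_zero h1 h2
  refine h.mem_of_conj g ⟨L ⊓ K.map (MulAut.conj g).toMonoidHom, inf_le_left.trans hLK,
    Subgroup.relIndex_ne_zero_trans (fun h0 => h3 ?_) hLi, fun l hl => ?_⟩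
  · exact Subgroup.relIndex_eq_zero_of_le_right (le_lineStab hwL) h0
  · obtain ⟨hlL, x, hx, rfl⟩ := Subgroup.mem_inf.1 hl
    have e : g⁻¹ * (MulAut.conj g).toMonoidHom x * g = x := by simp [mul_assoc]
    rw [e]
    refine ⟨hx, weight_eq hw ?_⟩
    rw [← hact x hx, ← hwL _ hlL]
    rfl

end MaximalWeight

end WeightVectors

section Independence

variable {G : Type*} [Group G] {V : Type*} [AddCommGroup V] [Module ℂ V]

/-- The action of `G` on finitely supported functions from `G ⧸ P` to a representation. -/
noncomputable def quotTranslate (ρ : G →* Module.End ℂ V) (P : Subgroup G) (l : G) :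
    (G ⧸ P →₀ V) →ₗ[ℂ] (G ⧸ P →₀ V) :=
  (Finsupp.mapRange.linearMap (ρ l)) ∘ₗ
    (Finsupp.domLCongr (MulAction.toPerm l : Equiv.Perm (G ⧸ P))).toLinearMap

theorem quotTranslate_apply (ρ : G →* Module.End ℂ V) (P : Subgroup G) (l : G) (φ : G ⧸ P →₀ V)
    (x : G ⧸ P) : quotTranslate ρ P l φ x = ρ l (φ (l⁻¹ • x)) := by
  simp [quotTranslate, Finsupp.domLCongr_apply, Finsupp.equivMapDomain_apply]

/-- Functions on `G ⧸ P` whose value at `gP` has weight conjugate under `g` to `(K, χ)`. -/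
def weightFunctions (ρ : G →* Module.End ℂ V) (P K : Subgroup G) (χ : G → ℂ) :
    Submodule ℂ (G ⧸ P →₀ V) where
  carrier := {φ | ∀ g : G, ρ g⁻¹ (φ (g : G ⧸ P)) ∈ weightVectors ρ K χ}
  add_mem' := fun ha hb g => by
    rw [Finsupp.add_apply, map_add]; exact add_mem (ha g) (hb g)
  zero_mem' := fun g => by simp
  smul_mem' := fun c φ h g => by
    rw [Finsupp.smul_apply, map_smul]; exact Submodule.smul_mem _ c (h g)

theorem quotTranslate_mem_weightFunctions {ρ : G →* Module.End ℂ V} {P K : Subgroup G} {χ : G → ℂ}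
    {φ : G ⧸ P →₀ V} (hφ : φ ∈ weightFunctions ρ P K χ) (l : G) :
    quotTranslate ρ P l φ ∈ weightFunctions ρ P K χ := by
  intro g
  have h := hφ (l⁻¹ * g)
  rw [quotTranslate_apply, apply_apply_eq]
  rwa [mul_inv_rev, inv_inv] at h

theorem IsCyclicChain.conj_mem_sup_fixer {k : ℕ} {N : ℕ → Subgroup G} (hN : IsCyclicChain k N)
    {B : Subgroup G} (hB : B ≤ hN.fixer) {i : ℕ} (hi : i ≤ k) :
    ∀ l ∈ B ⊔ (hN.fixer ⊓ N i), ∀ a ∈ B ⊔ (hN.fixer ⊓ N (i + 1)),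
      l * a * l⁻¹ ∈ B ⊔ (hN.fixer ⊓ N (i + 1)) := by
  set A := B ⊔ (hN.fixer ⊓ N (i + 1)) with hA
  have := hN.normal (i + 1)
  have := hN.fixer_normal
  have key : ∀ f ∈ hN.fixer ⊓ N i, A ≤ A.comap (MulAut.conj f).toMonoidHom := by
    intro f hf
    obtain ⟨hfF, hfN⟩ := Subgroup.mem_inf.1 hf
    refine sup_le (fun x hx => ?_) fun x hx => ?_
    · have h1 := inv_mem (hN.mem_fixer.1 (hB hx) i hi f hfN)
      have h2 : f * x * f⁻¹ * x⁻¹ ∈ hN.fixer :=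
        mul_mem (mul_mem (mul_mem hfF (hB hx)) (inv_mem hfF)) (inv_mem (hB hx))
      have h3 : f * x * f⁻¹ * x⁻¹ ∈ A := Subgroup.mem_sup_right (Subgroup.mem_inf.2 ⟨h2, by
        simpa [mul_assoc] using h1⟩)
      have h4 := mul_mem h3 (Subgroup.mem_sup_left hx : x ∈ A)
      rw [inv_mul_cancel_right] at h4
      exact h4
    · exact Subgroup.mem_sup_right ((inferInstance : (hN.fixer ⊓ N (i + 1)).Normal).conj_mem x hx f)
  have hle : B ⊔ (hN.fixer ⊓ N i) ≤ Subgroup.normalizer (A : Set G) := by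
    refine sup_le (le_sup_left.trans Subgroup.le_normalizer) fun f hf => ?_
    rw [Subgroup.mem_normalizer_iff]
    refine fun a => ⟨fun ha => key f hf ha, fun ha => ?_⟩
    have := key f⁻¹ (inv_mem hf) ha
    simpa [mul_assoc] using this
  exact fun l hl a ha => (Subgroup.mem_normalizer_iff.1 (hle hl) a).1 ha

namespace MaximalWeight

variable {k : ℕ} {N : ℕ → Subgroup G} {hN : IsCyclicChain k N} {ρ : G →* Module.End ℂ V}
  {P K : Subgroup G} {χ : G → ℂ}

theorem char_ne_zero (h : MaximalWeight ρ hN P K χ) {x : G} (hx : x ∈ K) : χ x ≠ 0 := by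
  obtain ⟨v, hv, hvW⟩ := h.nonzero
  intro h0
  have := hvW x hx
  rw [h0, zero_smul] at this
  exact apply_ne_zero ρ x hv this

theorem conj_smul_mk (h : MaximalWeight ρ hN P K χ) (g : G) {x : G} (hx : x ∈ K) :
    (g * x * g⁻¹) • (g : G ⧸ P) = g := by
  rw [MulAction.Quotient.smul_coe, smul_eq_mul, inv_mul_cancel_right, QuotientGroup.eq]
  simpa using inv_mem (h.le hx)

theorem eq_single_of_translate (h : MaximalWeight ρ hN P K χ) {ψ : G ⧸ P →₀ V}
    (hψ : ψ ∈ weightFunctions ρ P K χ) {g : G}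
    (hT : ∀ x ∈ K, quotTranslate ρ P (g * x * g⁻¹) ψ = χ x • ψ) (y : G ⧸ P) (hy : ψ y ≠ 0) :
    y = g := by
  have hval : ∀ x ∈ K, ∀ z, ρ (g * x * g⁻¹) (ψ ((g * x * g⁻¹)⁻¹ • z)) = χ x • ψ z := by
    intro x hx z
    rw [← quotTranslate_apply, hT x hx, Finsupp.smul_apply]
  let L := K ⊓ (MulAction.stabilizer G y).comap (MulAut.conj g).toMonoidHom
  have hLK : L ≤ K := inf_le_left
  have hLmem : ∀ x, x ∈ L ↔ x ∈ K ∧ (g * x * g⁻¹) • y = y := by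
    intro x
    simp [L, Subgroup.mem_inf, MulAction.mem_stabilizer_iff]
  have hLi : L.relIndex K ≠ 0 := by
    refine hN.relIndex_ne_zero_of_pow hLK fun x hx => ?_
    have hsupp : ∀ n : ℕ, ((g * x * g⁻¹) ^ n)⁻¹ • y ∈ ψ.support := by
      intro n
      rw [conj_pow, Finsupp.mem_support_iff]
      intro h0
      have := hval (x ^ n) (pow_mem hx n) y
      rw [h0, map_zero, eq_comm, smul_eq_zero] at this
      exact this.elim (h.char_ne_zero (pow_mem hx n)) hy
    obtain ⟨a, b, hab, he⟩ := Finite.exists_ne_map_eq_of_infinite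
      (fun n : ℕ => (⟨_, hsupp n⟩ : ψ.support))
    wlog hlt : a < b generalizing a b
    · exact this b a hab.symm he.symm (by omega)
    have he' : ((g * x * g⁻¹) ^ a)⁻¹ • y = ((g * x * g⁻¹) ^ b)⁻¹ • y := congrArg Subtype.val he
    refine ⟨b - a, by omega, (hLmem _).2 ⟨pow_mem hx _, ?_⟩⟩
    obtain ⟨c, rfl⟩ := Nat.exists_eq_add_of_le hlt.le
    rw [pow_add, mul_inv_rev, inv_smul_eq_iff, smul_smul] at he'
    rw [Nat.add_sub_cancel_left, ← conj_pow]
    have hcomm : (g * x * g⁻¹) ^ a * (((g * x * g⁻¹) ^ c)⁻¹ * ((g * x * g⁻¹) ^ a)⁻¹) =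
        ((g * x * g⁻¹) ^ c)⁻¹ := by
      rw [← mul_inv_rev, ← pow_add, add_comm a c, pow_add, mul_inv_rev, mul_inv_cancel_left]
    rw [hcomm, eq_inv_smul_iff] at he'
    exact he'
  obtain ⟨g', rfl⟩ := QuotientGroup.mk_surjective y
  have hmem : g⁻¹ * g' ∈ P := by
    refine h.mem_of_common_weight hLK hLi (w := ρ g⁻¹ (ψ g')) (apply_ne_zero ρ _ hy) ?_ ?_
    · intro x hx
      obtain ⟨hxK, hxy⟩ := (hLmem x).1 hx
      have h1 := hval x hxK g'
      rw [← hxy, inv_smul_smul, hxy] at h1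
      rw [← map_smul, ← h1, apply_apply_eq, apply_apply_eq]
      congr 2
      group
    · rw [apply_apply_eq]
      have := hψ g'
      simpa using this
  exact (QuotientGroup.eq.2 hmem).symm

/-- If every stable submodule supported on one orbit of `L` contains a function supported at one
point, then so does every stable submodule. -/
theorem exists_single_of_orbits (h : MaximalWeight ρ hN P K χ) {L : Subgroup G}
    {U : Submodule ℂ (G ⧸ P →₀ V)} (hUE : U ≤ weightFunctions ρ P K χ)
    (hUL : ∀ l ∈ L, ∀ φ ∈ U, quotTranslate ρ P l φ ∈ U)
    (hsupp : ∀ φ ∈ U, ∀ g : G, φ (g : G ⧸ P) ≠ 0 → ∀ x ∈ K, g * x * g⁻¹ ∈ L)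
    (ih : ∀ (g₀ : G) (U' : Submodule ℂ (G ⧸ P →₀ V)), (∃ φ ∈ U, φ (g₀ : G ⧸ P) ≠ 0) →
      U' ≤ weightFunctions ρ P K χ →
      (∀ l ∈ L, ∀ φ ∈ U', quotTranslate ρ P l φ ∈ U') →
      (∀ φ ∈ U', ∀ y, φ y ≠ 0 → ∃ l ∈ L, y = l • (g₀ : G ⧸ P)) → U' ≠ ⊥ →
      ∃ x w, w ≠ 0 ∧ Finsupp.single x w ∈ U')
    (hU : U ≠ ⊥) : ∃ x w, w ≠ 0 ∧ Finsupp.single x w ∈ U := by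
  classical
  let b : G ⧸ P → MulAction.orbitRel.Quotient L (G ⧸ P) := Quotient.mk''
  have hb : ∀ x y, b x = b y ↔ ∃ l ∈ L, x = l • y := by
    intro x y
    have : b x = b y ↔ x ∈ MulAction.orbit L y := Quotient.eq''.trans (MulAction.orbitRel_apply)
    rw [this]
    constructor
    · rintro ⟨l, hl⟩
      exact ⟨l, l.2, hl.symm⟩
    · rintro ⟨l, hl, rfl⟩
      exact ⟨⟨l, hl⟩, rfl⟩
  have hbl : ∀ l ∈ L, ∀ x, b (l • x) = b x := fun l hl x => (hb _ _).2 ⟨l, hl, rfl⟩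
  obtain ⟨φ₁, hφ₁, hφ₁0⟩ := Submodule.exists_mem_ne_zero_of_ne_bot hU
  obtain ⟨φ, ⟨hφU, hφ0⟩, hmin⟩ :=
    (measure fun φ : G ⧸ P →₀ V => (φ.support.image b).card).wf.has_min
      {φ | φ ∈ U ∧ φ ≠ 0} ⟨φ₁, hφ₁, hφ₁0⟩
  obtain ⟨x₀, hx₀⟩ := Finsupp.ne_iff.1 hφ0
  rw [Finsupp.zero_apply] at hx₀
  let U₁ : Submodule ℂ (G ⧸ P →₀ V) :=
    { carrier := {ψ | ψ ∈ U ∧ ∀ x, ψ x ≠ 0 → ∃ y, φ y ≠ 0 ∧ b y = b x}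
      add_mem' := by
        rintro ψ η ⟨h1, h2⟩ ⟨h3, h4⟩
        refine ⟨add_mem h1 h3, fun x hx => ?_⟩
        by_cases h0 : ψ x = 0
        · exact h4 x (by simpa [h0] using hx)
        · exact h2 x h0
      zero_mem' := ⟨zero_mem _, by simp⟩
      smul_mem' := by
        rintro c ψ ⟨h1, h2⟩
        exact ⟨Submodule.smul_mem _ c h1, fun x hx => h2 x fun h0 => hx (by simp [h0])⟩ }
  have hU₁L : ∀ l ∈ L, ∀ ψ ∈ U₁, quotTranslate ρ P l ψ ∈ U₁ := by
    rintro l hl ψ ⟨h1, h2⟩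
    refine ⟨hUL l hl ψ h1, fun x hx => ?_⟩
    rw [quotTranslate_apply] at hx
    obtain ⟨y, hy, hyx⟩ := h2 (l⁻¹ • x) fun h0 => hx (by rw [h0, map_zero])
    exact ⟨y, hy, hyx.trans (hbl _ (inv_mem hl) x)⟩
  have hvanish : ∀ ψ ∈ U₁, (∀ x, b x = b x₀ → ψ x = 0) → ψ = 0 := by
    rintro ψ ⟨h1, h2⟩ h3
    by_contra h0
    refine hmin ψ ⟨h1, h0⟩ (Finset.card_lt_card ?_)
    rw [Finset.ssubset_iff_of_subset]
    · refine ⟨b x₀, Finset.mem_image_of_mem b (Finsupp.mem_support_iff.2 hx₀), fun hm => ?_⟩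
      obtain ⟨x, hx, hxb⟩ := Finset.mem_image.1 hm
      exact Finsupp.mem_support_iff.1 hx (h3 x hxb)
    · intro c hc
      obtain ⟨x, hx, rfl⟩ := Finset.mem_image.1 hc
      obtain ⟨y, hy, hyx⟩ := h2 x (Finsupp.mem_support_iff.1 hx)
      exact Finset.mem_image.2 ⟨y, Finsupp.mem_support_iff.2 hy, hyx⟩
  let U₂ : Submodule ℂ (G ⧸ P →₀ V) :=
    { carrier := {η | (∀ x, b x ≠ b x₀ → η x = 0) ∧ ∃ ψ ∈ U₁, ∀ x, b x = b x₀ → η x = ψ x}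
      add_mem' := by
        rintro η θ ⟨h1, ψ, hψ, h2⟩ ⟨h3, ξ, hξ, h4⟩
        exact ⟨fun x hx => by simp [h1 x hx, h3 x hx], ψ + ξ, add_mem hψ hξ,
          fun x hx => by simp [h2 x hx, h4 x hx]⟩
      zero_mem' := ⟨by simp, 0, zero_mem _, by simp⟩
      smul_mem' := by
        rintro c η ⟨h1, ψ, hψ, h2⟩
        exact ⟨fun x hx => by simp [h1 x hx], c • ψ, Submodule.smul_mem _ c hψ,
          fun x hx => by simp [h2 x hx]⟩ }
  obtain ⟨g₀, rfl⟩ := QuotientGroup.mk_surjective x₀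
  obtain ⟨x, w, hw, hxO, ψ, hψ, hψO⟩ := ih g₀ U₂ ⟨φ, hφU, hx₀⟩
    (by
      rintro η ⟨h1, ψ, hψ, h2⟩ g
      by_cases hg : b g = b g₀
      · rw [h2 _ hg]; exact hUE hψ.1 g
      · rw [h1 _ hg, map_zero]; exact zero_mem _)
    (by
      rintro l hl η ⟨h1, ψ, hψ, h2⟩
      refine ⟨fun x hx => ?_, _, hU₁L l hl ψ hψ, fun x hx => ?_⟩
      · rw [quotTranslate_apply, h1, map_zero]
        rwa [hbl _ (inv_mem hl)]
      · rw [quotTranslate_apply, quotTranslate_apply, h2]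
        rwa [hbl _ (inv_mem hl)])
    (by
      rintro η ⟨h1, -⟩ y hy
      rw [← hb]
      by_contra h0
      exact hy (h1 y h0))
    (by
      rw [Submodule.ne_bot_iff]
      refine ⟨φ.filter fun x => b x = b g₀, ⟨fun x hx => ?_, φ, ⟨hφU, fun x hx => ⟨x, hx, rfl⟩⟩,
        fun x hx => ?_⟩, fun h0 => hx₀ ?_⟩
      · rw [Finsupp.filter_apply_neg (fun x => b x = b g₀) φ hx]
      · rw [Finsupp.filter_apply_pos (fun x => b x = b g₀) φ hx]
      · have := DFunLike.congr_fun h0 (g₀ : G ⧸ P)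
        rwa [Finsupp.filter_apply_pos (fun x => b x = b g₀) φ rfl] at this)
  have hxb : b x = b g₀ := by
    by_contra h0
    exact hw (by simpa using hxO x h0)
  have hψx : ψ x = w := by simpa using (hψO x hxb).symm
  have hψne : ∀ y, b y = b x → y ≠ x → ψ y = 0 := by
    intro y hy hyx
    rw [← hψO y (hy.trans hxb), Finsupp.single_apply, if_neg (Ne.symm hyx)]
  obtain ⟨g, rfl⟩ := QuotientGroup.mk_surjective x
  have hT : ∀ a ∈ K, quotTranslate ρ P (g * a * g⁻¹) ψ = χ a • ψ := by
    intro a ha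
    have hl : g * a * g⁻¹ ∈ L := hsupp ψ hψ.1 g (hψx ▸ hw) a ha
    rw [← sub_eq_zero]
    refine hvanish _ (sub_mem (hU₁L _ hl ψ hψ) (Submodule.smul_mem _ _ hψ)) fun y hy => ?_
    rw [Finsupp.sub_apply, Finsupp.smul_apply, quotTranslate_apply, sub_eq_zero]
    by_cases hyx : y = g
    · subst hyx
      have h1 : (g * a * g⁻¹)⁻¹ • (g : G ⧸ P) = g := by
        rw [inv_smul_eq_iff, h.conj_smul_mk g ha]
      rw [h1, mul_assoc, ← apply_apply_eq, ← apply_apply_eq, hUE hψ.1 g a ha, map_smul,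
        apply_inv_apply]
    · rw [hψne y (hy.trans hxb.symm) hyx, smul_zero, hψne, map_zero]
      · rw [hbl _ (inv_mem hl), hy, hxb]
      · intro h1
        rw [inv_smul_eq_iff, h.conj_smul_mk g ha] at h1
        exact hyx h1
  refine ⟨g, w, hw, ?_⟩
  have : Finsupp.single (g : G ⧸ P) w = ψ := by
    ext y
    by_cases hyx : y = g
    · rw [hyx, Finsupp.single_eq_same, hψx]
    · rw [Finsupp.single_apply, if_neg (Ne.symm hyx), eq_comm]
      by_contra h0
      exact hyx (h.eq_single_of_translate (hUE hψ.1) hT y h0)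
  rw [this]
  exact hψ.1

/-- Every nonzero stable space of weight functions contains a function supported at one point. -/
theorem exists_single_of_level (h : MaximalWeight ρ hN P K χ) : ∀ i ≤ k + 1,
    ∀ (L : Subgroup G) (U : Submodule ℂ (G ⧸ P →₀ V)), U ≤ weightFunctions ρ P K χ →
    (∀ l ∈ L, ∀ φ ∈ U, quotTranslate ρ P l φ ∈ U) →
    (∀ φ ∈ U, ∀ g : G, φ (g : G ⧸ P) ≠ 0 →
      K.map (MulAut.conj g).toMonoidHom ⊔ (hN.fixer ⊓ N i) = L) →
    U ≠ ⊥ → ∃ x w, w ≠ 0 ∧ Finsupp.single x w ∈ U := by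
  classical
  have hcL : ∀ (i : ℕ) (L : Subgroup G) (g : G),
      K.map (MulAut.conj g).toMonoidHom ⊔ (hN.fixer ⊓ N i) = L → ∀ x ∈ K, g * x * g⁻¹ ∈ L := by
    rintro i L g rfl x hx
    exact Subgroup.mem_sup_left ⟨x, hx, by simp⟩
  refine descending_induction ?_ ?_
  · intro L U hUE hUL hsupp hU
    refine h.exists_single_of_orbits hUE hUL (fun φ hφ g hg => hcL _ L g (hsupp φ hφ g hg)) ?_ hU
    rintro g₀ U' ⟨φ, hφ, hφg₀⟩ - - horb hU'
    obtain ⟨η, hη, hη0⟩ := Submodule.exists_mem_ne_zero_of_ne_bot hU'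
    have hy : ∀ y, η y ≠ 0 → y = g₀ := by
      intro y hy
      obtain ⟨l, hl, rfl⟩ := horb η hη y hy
      rw [← hsupp φ hφ g₀ hφg₀, hN.bot, inf_bot_eq, sup_bot_eq] at hl
      obtain ⟨x, hx, rfl⟩ := hl
      exact h.conj_smul_mk g₀ hx
    have hη1 : η = Finsupp.single (g₀ : G ⧸ P) (η g₀) := by
      ext y
      by_cases hyg : y = g₀
      · rw [hyg, Finsupp.single_eq_same]
      · rw [Finsupp.single_apply, if_neg (Ne.symm hyg)]
        by_contra h0
        exact hyg (hy y h0)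
    refine ⟨g₀, η g₀, fun h0 => hη0 ?_, hη1 ▸ hη⟩
    rw [hη1, h0, Finsupp.single_zero]
  · intro i hi ih L U hUE hUL hsupp hU
    refine h.exists_single_of_orbits hUE hUL (fun φ hφ g hg => hcL _ L g (hsupp φ hφ g hg)) ?_ hU
    rintro g₀ U' ⟨φ, hφ, hφg₀⟩ hU'E hU'L horb hU'
    have hL := hsupp φ hφ g₀ hφg₀
    have hFi : hN.fixer ⊓ N (i + 1) ≤ hN.fixer ⊓ N i := inf_le_inf_left _ (hN.le i)
    refine ih (K.map (MulAut.conj g₀).toMonoidHom ⊔ (hN.fixer ⊓ N (i + 1))) U' hU'E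
      (fun l hl => hU'L l ?_) ?_ hU'
    · rw [← hL]
      exact sup_le_sup_left hFi _ hl
    · intro η hη g hg
      obtain ⟨l, hl, hgl⟩ := horb η hη _ hg
      obtain ⟨p, hp, rfl⟩ : ∃ p ∈ P, g = l * g₀ * p := by
        rw [MulAction.Quotient.smul_coe, smul_eq_mul, eq_comm, QuotientGroup.eq] at hgl
        exact ⟨_, hgl, (mul_inv_cancel_left _ _).symm⟩
      have hB : K.map (MulAut.conj g₀).toMonoidHom ≤ hN.fixer := by
        rintro _ ⟨x, hx, rfl⟩
        exact hN.fixer_normal.conj_mem x (h.le_fixer hx) g₀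
      rw [← hL] at hl
      have hconj := hN.conj_mem_sup_fixer hB hi l hl
      have := hN.normal (i + 1)
      have hFn := hN.fixer_normal
      apply le_antisymm
      · refine sup_le ?_ le_sup_right
        rintro _ ⟨x, hx, rfl⟩
        have h1 := hconj (g₀ * (p * x * p⁻¹) * g₀⁻¹)
          (Subgroup.mem_sup_left ⟨_, h.conj_mem p hp x hx, rfl⟩)
        simpa [mul_assoc] using h1
      · set A := K.map (MulAut.conj (l * g₀ * p)).toMonoidHom ⊔ (hN.fixer ⊓ N (i + 1))
        have h1 : K.map (MulAut.conj g₀).toMonoidHom ⊔ (hN.fixer ⊓ N (i + 1)) ≤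
            A.comap (MulAut.conj l).toMonoidHom := by
          refine sup_le ?_ fun x hx => Subgroup.mem_sup_right
            ((inferInstance : (hN.fixer ⊓ N (i + 1)).Normal).conj_mem x hx l)
          rintro _ ⟨x, hx, rfl⟩
          exact Subgroup.mem_sup_left ⟨_, h.conj_mem' p hp x hx, by simp [mul_assoc]⟩
        intro a ha
        have h2 := h1 (hN.conj_mem_sup_fixer hB hi _ (inv_mem hl) a ha)
        simpa [mul_assoc] using h2

end MaximalWeight

end Independence

section Decomposition

variable {G : Type*} [Group G] {V : Type*} [AddCommGroup V] [Module ℂ V]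

/-- The sum of the values of a finitely supported function. -/
noncomputable def valueSum (P : Subgroup G) (V : Type*) [AddCommGroup V] [Module ℂ V] :
    (G ⧸ P →₀ V) →ₗ[ℂ] V :=
  Finsupp.lsum ℂ fun _ => LinearMap.id

theorem valueSum_single (P : Subgroup G) (x : G ⧸ P) (v : V) :
    valueSum P V (Finsupp.single x v) = v := by
  simp [valueSum]

theorem quotTranslate_single (ρ : G →* Module.End ℂ V) (P : Subgroup G) (l : G) (x : G ⧸ P)
    (v : V) : quotTranslate ρ P l (Finsupp.single x v) = Finsupp.single (l • x) (ρ l v) := by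
  simp [quotTranslate, Finsupp.domLCongr_apply, Finsupp.equivMapDomain_single]

theorem valueSum_quotTranslate (ρ : G →* Module.End ℂ V) (P : Subgroup G) (l : G)
    (φ : G ⧸ P →₀ V) : valueSum P V (quotTranslate ρ P l φ) = ρ l (valueSum P V φ) := by
  induction φ using Finsupp.induction_linear with
  | zero => simp
  | add f g hf hg => rw [map_add, map_add, map_add, map_add, hf, hg]
  | single x v => rw [quotTranslate_single, valueSum_single, valueSum_single]

namespace MaximalWeight

variable {k : ℕ} {N : ℕ → Subgroup G} {hN : IsCyclicChain k N} {ρ : G →* Module.End ℂ V}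
  {P K : Subgroup G} {χ : G → ℂ}

/-- The translates of the weight vectors of `(K, χ)` by `G ⧸ P` are independent. -/
theorem eq_zero_of_valueSum_eq_zero (h : MaximalWeight ρ hN P K χ) {φ : G ⧸ P →₀ V}
    (hφ : φ ∈ weightFunctions ρ P K χ) (h0 : valueSum P V φ = 0) : φ = 0 := by
  by_contra hne
  obtain ⟨x, w, hw, -, hxw⟩ := h.exists_single_of_level 0 (Nat.zero_le _) hN.fixer
    (weightFunctions ρ P K χ ⊓ LinearMap.ker (valueSum P V)) inf_le_left
    (by
      rintro l - φ ⟨h1, h2⟩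
      refine ⟨quotTranslate_mem_weightFunctions h1 l, ?_⟩
      rw [SetLike.mem_coe, LinearMap.mem_ker] at h2 ⊢
      rw [valueSum_quotTranslate, h2, map_zero])
    (by
      rintro φ - g -
      rw [hN.top, inf_top_eq]
      refine sup_eq_right.2 ?_
      rintro _ ⟨x, hx, rfl⟩
      exact hN.fixer_normal.conj_mem x (h.le_fixer hx) g)
    ((Submodule.ne_bot_iff _).2 ⟨φ, ⟨hφ, h0⟩, hne⟩)
  rw [SetLike.mem_coe, LinearMap.mem_ker, valueSum_single] at hxw
  exact hw hxw

theorem single_mem_weightFunctions (h : MaximalWeight ρ hN P K χ) {w : V}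
    (hw : w ∈ weightVectors ρ K χ) (g : G) :
    Finsupp.single (g : G ⧸ P) (ρ g w) ∈ weightFunctions ρ P K χ := by
  classical
  intro g'
  rw [Finsupp.single_apply]
  split_ifs with hgg
  · rw [apply_apply_eq]
    refine h.apply_mem ?_ hw
    simpa using inv_mem (QuotientGroup.eq.1 hgg)
  · rw [map_zero]; exact zero_mem _

/-- An irreducible representation is the sum of the translates of the weight vectors of `(K, χ)`. -/
theorem exists_valueSum_eq (h : MaximalWeight ρ hN P K χ)
    (hirr : ∀ U : Submodule ℂ V, (∀ g, ∀ u ∈ U, ρ g u ∈ U) → U ≠ ⊥ → U = ⊤) (v : V) :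
    ∃ φ ∈ weightFunctions ρ P K χ, valueSum P V φ = v := by
  have htop := hirr ((weightFunctions ρ P K χ).map (valueSum P V))
    (by
      rintro g _ ⟨φ, hφ, rfl⟩
      exact ⟨_, quotTranslate_mem_weightFunctions hφ g, valueSum_quotTranslate ρ P g φ⟩)
    (by
      obtain ⟨w, hw, hwW⟩ := h.nonzero
      refine (Submodule.ne_bot_iff _).2 ⟨ρ 1 w, ⟨_, h.single_mem_weightFunctions hwW 1, ?_⟩,
        apply_ne_zero ρ 1 hw⟩
      rw [valueSum_single])
  have : v ∈ (weightFunctions ρ P K χ).map (valueSum P V) := htop ▸ Submodule.mem_top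
  exact this

/-- A finite-dimensional weight space gives one inside the weight vectors of `(K, χ)`. -/
theorem exists_finiteDimensional_inf (h : MaximalWeight ρ hN P K χ)
    (hirr : ∀ U : Submodule ℂ V, (∀ g, ∀ u ∈ U, ρ g u ∈ U) → U ≠ ⊥ → U = ⊤)
    {H : Subgroup G} {ψ : G → ℂ} (hne : weightVectors ρ H ψ ≠ ⊥)
    (hfd : FiniteDimensional ℂ (weightVectors ρ H ψ)) :
    ∃ (H₁ : Subgroup G) (ψ₁ : G → ℂ), H₁ ≤ P ∧ weightVectors ρ K χ ⊓ weightVectors ρ H₁ ψ₁ ≠ ⊥ ∧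
      FiniteDimensional ℂ ↥(weightVectors ρ K χ ⊓ weightVectors ρ H₁ ψ₁) := by
  classical
  obtain ⟨v, hv, hv0⟩ := Submodule.exists_mem_ne_zero_of_ne_bot hne
  have hψmul : ∀ a ∈ H, ∀ b ∈ H, ψ (a * b) = ψ a * ψ b := by
    intro a ha b hb
    refine weight_eq hv0 ?_
    rw [← hv _ (mul_mem ha hb), ← apply_apply_eq, hv b hb, map_smul, hv a ha, smul_smul, mul_comm]
  have hψ0 : ∀ a ∈ H, ψ a ≠ 0 := by
    intro a ha h0
    have := hv a ha
    rw [h0, zero_smul] at this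
    exact apply_ne_zero ρ a hv0 this
  let e : weightFunctions ρ P K χ ≃ₗ[ℂ] V :=
    LinearEquiv.ofBijective ((valueSum P V).domRestrict (weightFunctions ρ P K χ))
      ⟨by
        rw [← LinearMap.ker_eq_bot, LinearMap.ker_eq_bot']
        rintro ⟨φ, hφ⟩ h0
        exact Subtype.ext (h.eq_zero_of_valueSum_eq_zero hφ h0),
      fun v => by
        obtain ⟨φ, hφ, he⟩ := h.exists_valueSum_eq hirr v
        exact ⟨⟨φ, hφ⟩, he⟩⟩
  have he : ∀ φ, e φ = valueSum P V φ.1 := fun φ => rfl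
  set φ := e.symm v with hφ
  have hφv : valueSum P V φ.1 = v := by rw [← he, hφ, LinearEquiv.apply_symm_apply]
  have hTφ : ∀ a ∈ H, quotTranslate ρ P a φ.1 = ψ a • φ.1 := by
    intro a ha
    rw [← sub_eq_zero]
    refine h.eq_zero_of_valueSum_eq_zero
      (sub_mem (quotTranslate_mem_weightFunctions φ.2 a) (Submodule.smul_mem _ _ φ.2)) ?_
    rw [map_sub, map_smul, valueSum_quotTranslate, hφv, hv a ha, sub_self]
  have hφ0 : φ.1 ≠ 0 := by
    intro h0
    rw [h0, map_zero] at hφv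
    exact hv0 hφv.symm
  obtain ⟨x, hx⟩ := Finsupp.ne_iff.1 hφ0
  rw [Finsupp.zero_apply] at hx
  obtain ⟨g, rfl⟩ := QuotientGroup.mk_surjective x
  have hval : ∀ a ∈ H, ∀ y, ρ a (φ.1 (a⁻¹ • y)) = ψ a • φ.1 y := by
    intro a ha y
    rw [← quotTranslate_apply, hTφ a ha, Finsupp.smul_apply]
  have horb : ∀ a ∈ H, a • (g : G ⧸ P) ∈ φ.1.support := by
    intro a ha
    rw [Finsupp.mem_support_iff]
    intro h0
    have := hval a⁻¹ (inv_mem ha) (g : G ⧸ P)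
    rw [inv_inv, h0, map_zero, eq_comm, smul_eq_zero] at this
    exact this.elim (hψ0 _ (inv_mem ha)) hx
  let H₁ := P ⊓ H.comap (MulAut.conj g).toMonoidHom
  let ψ₁ : G → ℂ := fun a => ψ (g * a * g⁻¹)
  have hH₁ : ∀ a, a ∈ H₁ ↔ a ∈ P ∧ g * a * g⁻¹ ∈ H := fun a => by simp [H₁, Subgroup.mem_inf]
  have hfix : ∀ a ∈ P, (g * a * g⁻¹)⁻¹ • (g : G ⧸ P) = g := by
    intro a ha
    rw [inv_smul_eq_iff, MulAction.Quotient.smul_coe, smul_eq_mul, inv_mul_cancel_right,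
      QuotientGroup.eq]
    simpa using ha
  refine ⟨H₁, ψ₁, inf_le_left, ?_, ?_⟩
  · refine (Submodule.ne_bot_iff _).2 ⟨ρ g⁻¹ (φ.1 g), ⟨φ.2 g, fun a ha => ?_⟩,
      apply_ne_zero ρ _ hx⟩
    obtain ⟨haP, haH⟩ := (hH₁ a).1 ha
    have := hval _ haH (g : G ⧸ P)
    rw [hfix a haP] at this
    rw [← map_smul, ← this, apply_apply_eq, apply_apply_eq]
    congr 2
    group
  · let ev : V →ₗ[ℂ] V := ρ g⁻¹ ∘ₗ Finsupp.lapply (g : G ⧸ P) ∘ₗ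
      (weightFunctions ρ P K χ).subtype ∘ₗ e.symm.toLinearMap
    have hle : weightVectors ρ K χ ⊓ weightVectors ρ H₁ ψ₁ ≤ (weightVectors ρ H ψ).map ev := by
      rintro w ⟨hwK, hwH⟩
      have hc : ∀ y : G ⧸ P, ∃ u : V, ((∀ a ∈ H, y ≠ a • (g : G ⧸ P)) → u = 0) ∧
          ∀ a ∈ H, y = a • (g : G ⧸ P) → u = (ψ a)⁻¹ • ρ a (ρ g w) := by
        intro y
        by_cases hy : ∃ a ∈ H, y = a • (g : G ⧸ P)
        · obtain ⟨a, ha, rfl⟩ := hy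
          refine ⟨(ψ a)⁻¹ • ρ a (ρ g w), fun h0 => absurd rfl (h0 a ha), fun b hb hab => ?_⟩
          have hP : g⁻¹ * (a⁻¹ * b) * g ∈ P := by
            rw [MulAction.Quotient.smul_coe, MulAction.Quotient.smul_coe, QuotientGroup.eq] at hab
            simpa [mul_assoc] using hab
          have hmem : g⁻¹ * (a⁻¹ * b) * g ∈ H₁ :=
            (hH₁ _).2 ⟨hP, by simpa [mul_assoc] using mul_mem (inv_mem ha) hb⟩
          have h1 := hwH _ hmem
          have h2 : ψ₁ (g⁻¹ * (a⁻¹ * b) * g) = ψ (a⁻¹ * b) := by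
            simp [ψ₁, mul_assoc]
          rw [h2] at h1
          have h3 : ψ b = ψ a * ψ (a⁻¹ * b) := by
            rw [← hψmul a ha _ (mul_mem (inv_mem ha) hb), mul_inv_cancel_left]
          have h4 : ρ b (ρ g w) = ρ a (ρ g (ρ (g⁻¹ * (a⁻¹ * b) * g) w)) := by
            simp only [apply_apply_eq]; congr 2; group
          rw [h4, h1, map_smul, map_smul, smul_smul, h3, mul_inv, mul_assoc,
            inv_mul_cancel₀ (hψ0 _ (mul_mem (inv_mem ha) hb)), mul_one]
        · push Not at hy
          exact ⟨0, fun _ => rfl, fun a ha hay => absurd hay (hy a ha)⟩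
      choose u hu0 hu using hc
      let η : G ⧸ P →₀ V := Finsupp.onFinset φ.1.support u fun y hy => by
        by_contra hyn
        exact hy (hu0 y fun a ha hay => hyn (hay ▸ horb a ha))
      have hη : ∀ y, η y = u y := fun y => rfl
      have hηE : η ∈ weightFunctions ρ P K χ := by
        intro g'
        rw [hη]
        by_cases hy : ∃ a ∈ H, (g' : G ⧸ P) = a • (g : G ⧸ P)
        · obtain ⟨a, ha, hag⟩ := hy
          rw [hu _ a ha hag, map_smul, apply_apply_eq, apply_apply_eq]
          refine Submodule.smul_mem _ _ (h.apply_mem ?_ hwK)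
          rw [MulAction.Quotient.smul_coe, QuotientGroup.eq] at hag
          simpa [mul_assoc] using hag
        · push Not at hy
          rw [hu0 _ hy, map_zero]
          exact zero_mem _
      have hTη : ∀ a ∈ H, quotTranslate ρ P a η = ψ a • η := by
        intro a ha
        ext y
        rw [quotTranslate_apply, Finsupp.smul_apply, hη, hη]
        by_cases hy : ∃ b ∈ H, y = b • (g : G ⧸ P)
        · obtain ⟨b, hb, rfl⟩ := hy
          have h1 : ψ b = ψ a * ψ (a⁻¹ * b) := by
            rw [← hψmul a ha _ (mul_mem (inv_mem ha) hb), mul_inv_cancel_left]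
          rw [hu _ b hb rfl, hu _ (a⁻¹ * b) (mul_mem (inv_mem ha) hb) (smul_smul _ _ _), map_smul,
            apply_apply_eq, mul_inv_cancel_left, smul_smul, h1, mul_inv,
            mul_inv_cancel_left₀ (hψ0 a ha)]
        · push Not at hy
          rw [hu0 _ hy, hu0, map_zero, smul_zero]
          intro b hb hyb
          refine hy (a * b) (mul_mem ha hb) ?_
          rw [mul_smul, ← hyb, smul_inv_smul]
      refine ⟨valueSum P V η, fun a ha => ?_, ?_⟩
      · rw [← valueSum_quotTranslate, hTη a ha, map_smul]
      · have h1 : e.symm (valueSum P V η) = ⟨η, hηE⟩ := by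
          rw [LinearEquiv.symm_apply_eq, he]
        have h2 : ev (valueSum P V η) = ρ g⁻¹ ((e.symm (valueSum P V η)).1 (g : G ⧸ P)) := rfl
        rw [h2, h1, hη, hu _ 1 (one_mem H) (one_smul _ _).symm, map_smul]
        have h3 : ψ 1 = 1 := by
          have := hψmul 1 (one_mem H) 1 (one_mem H)
          rw [mul_one] at this
          exact (mul_eq_left₀ (hψ0 1 (one_mem H))).1 this.symm
        rw [h3, inv_one, one_smul, map_one, Module.End.one_apply, inv_apply_apply]
    exact Submodule.finiteDimensional_of_le hle

end MaximalWeight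

end Decomposition

section Commensurability

theorem exists_eigenvector_of_aeval {V : Type*} [AddCommGroup V] [Module ℂ V]
    {W : Submodule ℂ V} {f : Module.End ℂ V} (hf : ∀ w ∈ W, f w ∈ W) {w : V} (hw : w ∈ W)
    (hw0 : w ≠ 0) : ∀ (n : ℕ) (p : Polynomial ℂ), p.natDegree = n → p ≠ 0 →
    Polynomial.aeval f p w = 0 → ∃ v ∈ W, v ≠ 0 ∧ ∃ c : ℂ, f v = c • v := by
  intro n
  induction n with
  | zero =>
    intro p hpn hp h
    rw [Polynomial.eq_C_of_natDegree_eq_zero hpn, Polynomial.aeval_C, Module.algebraMap_end_apply,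
      smul_eq_zero] at h
    refine absurd (h.resolve_right hw0) fun h0 => hp ?_
    rw [Polynomial.eq_C_of_natDegree_eq_zero hpn, h0, map_zero]
  | succ n ih =>
    intro p hpn hp h
    obtain ⟨r, hr⟩ := IsAlgClosed.exists_root p (fun h0 => by
      rw [Polynomial.natDegree_eq_of_degree_eq_some (n := 0) h0] at hpn
      omega)
    obtain ⟨q, rfl⟩ := Polynomial.dvd_iff_isRoot.2 hr
    have hq : q ≠ 0 := right_ne_zero_of_mul hp
    have hqn : q.natDegree = n := by
      rw [Polynomial.natDegree_mul (Polynomial.X_sub_C_ne_zero r) hq,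
        Polynomial.natDegree_X_sub_C] at hpn
      omega
    by_cases h0 : Polynomial.aeval f q w = 0
    · exact ih q hqn hq h0
    · refine ⟨_, ?_, h0, r, ?_⟩
      · clear ih h h0 hpn hp hr hq hqn
        induction q using Polynomial.induction_on' with
        | add a b ha hb => rw [map_add]; exact add_mem ha hb
        | monomial m a =>
          rw [Polynomial.aeval_monomial, Module.End.mul_apply, Module.algebraMap_end_apply]
          refine Submodule.smul_mem _ _ ?_
          induction m with
          | zero => simpa using hw
          | succ m ih => rw [pow_succ', Module.End.mul_apply]; exact hf _ ih
      · rw [map_mul, Module.End.mul_apply, map_sub, Polynomial.aeval_X, Polynomial.aeval_C,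
          LinearMap.sub_apply, Module.algebraMap_end_apply, sub_eq_zero] at h
        exact h

variable {G : Type*} [Group G] {V : Type*} [AddCommGroup V] [Module ℂ V]

theorem apply_pow_eq_smul {ρ : G →* Module.End ℂ V} {W : Submodule ℂ V} {a b : G} {c : ℂ}
    (ha : ∀ w ∈ W, ρ a w ∈ W) (h : ∀ w ∈ W, ρ b w = c • ρ a w) (n : ℕ) :
    ∀ w ∈ W, ρ (b ^ n) w = c ^ n • ρ (a ^ n) w := by
  induction n with
  | zero => simp
  | succ n ih =>
    intro w hw
    rw [pow_succ b, ← apply_apply_eq, h w hw, map_smul, ih _ (ha w hw), smul_smul, apply_apply_eq,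
      ← pow_succ, ← pow_succ']

theorem apply_conj_pow_eq_smul {ρ : G →* Module.End ℂ V} {W : Submodule ℂ V} {q s : G} {c : ℂ}
    (hq : ∀ w ∈ W, ρ q⁻¹ w ∈ W) (h : ∀ w ∈ W, ρ (q * s * q⁻¹) w = c • ρ s w) (n : ℕ) :
    ∀ w ∈ W, ρ (q ^ n * s * (q ^ n)⁻¹) w = c ^ n • ρ s w := by
  induction n with
  | zero => simp
  | succ n ih =>
    intro w hw
    have e : q ^ (n + 1) * s * (q ^ (n + 1))⁻¹ = q * (q ^ n * s * (q ^ n)⁻¹) * q⁻¹ := by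
      rw [pow_succ']; group
    rw [e, ← apply_apply_eq, ← apply_apply_eq, ih _ (hq w hw), map_smul, apply_apply_eq,
      apply_apply_eq, h w hw, smul_smul, pow_succ]

namespace MaximalWeight

variable {k : ℕ} {N : ℕ → Subgroup G} {hN : IsCyclicChain k N} {ρ : G →* Module.End ℂ V}
  {P K : Subgroup G} {χ : G → ℂ}

theorem apply_conj_eq (h : MaximalWeight ρ hN P K χ) {x s : G} (hx : x ∈ K) (hs : s ∈ P) {w : V}
    (hw : w ∈ weightVectors ρ K χ) : ρ (x * s * x⁻¹) w = ρ s w := by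
  have key : ∀ u ∈ weightVectors ρ K χ, ρ (x * s) u = ρ (s * x) u := by
    intro u hu
    rw [← apply_apply_eq, ← apply_apply_eq, h.apply_mem hs hu x hx, hu x hx, map_smul]
  rw [← apply_apply_eq, key _ (h.apply_mem (inv_mem (h.le hx)) hw), apply_apply_eq,
    mul_inv_cancel_right]

/-- If no power of `t` lies in `N (i + 1)` and `i` is not a level of `K`, then no power of `t`
has an eigenvector among the weight vectors. -/
theorem false_of_eigenvector (h : MaximalWeight ρ hN P K χ) {i : ℕ} (hi : i ≤ k)
    (hiK : i ∉ levels k N K) {t : G} (htN : t ∈ N i) (ht : ∀ n : ℕ, 0 < n → t ^ n ∉ N (i + 1))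
    {n : ℕ} (hn : 0 < n) {w : V} (hw : w ∈ weightVectors ρ K χ) (hw0 : w ≠ 0) {c : ℂ}
    (hc : ρ (t ^ n) w = c • w) : False := by
  have h1 : insert i (levels k N K) ⊆ levels k N (lineStab ρ w) := by
    refine Finset.insert_subset (mem_levels.2 ⟨hi, t ^ n, mem_lineStab_of_smul hc,
      pow_mem htN n, fun m hm => ?_⟩) (levels_mono (le_lineStab hw))
    rw [← pow_mul]
    exact ht _ (Nat.mul_pos hn hm)
  have h2 := (Finset.card_le_card h1).trans (h.card_le w hw0)
  rw [Finset.card_insert_of_notMem hiK] at h2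
  omega

/-- A finite-dimensional weight space among the weight vectors of `(K, χ)` forces `K` to have
finite index in `P`. -/
theorem relIndex_ne_zero_of_finiteDimensional (h : MaximalWeight ρ hN P K χ) {H₁ : Subgroup G}
    {ψ₁ : G → ℂ} (hH₁ : H₁ ≤ P) (hne : weightVectors ρ K χ ⊓ weightVectors ρ H₁ ψ₁ ≠ ⊥)
    (hfd : FiniteDimensional ℂ ↥(weightVectors ρ K χ ⊓ weightVectors ρ H₁ ψ₁)) :
    K.relIndex P ≠ 0 := by
  classical
  set W := weightVectors ρ K χ with hW
  have hWP : ∀ p ∈ P, ∀ w ∈ W, ρ p w ∈ W := fun p hp w hw => h.apply_mem hp hw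
  obtain ⟨w₀, ⟨hw₀W, hw₀H⟩, hw₀⟩ := Submodule.exists_mem_ne_zero_of_ne_bot hne
  have hKH₁ : K.relIndex H₁ ≠ 0 := fun h0 =>
    h.relIndex_lineStab_ne_zero hw₀ (le_lineStab hw₀W) le_rfl
      (Subgroup.relIndex_eq_zero_of_le_right (le_lineStab hw₀H) h0)
  obtain ⟨m, hm, hmK⟩ : ∃ m, 0 < m ∧ ∀ x ∈ H₁, x ^ m ∈ K := by
    refine ⟨(K.relIndex H₁).factorial, Nat.factorial_pos _, fun x hx => ?_⟩
    obtain ⟨n, hn, hle, hxn⟩ := Subgroup.exists_pow_mem_of_relIndex_ne_zero hKH₁ hx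
    obtain ⟨d, hd⟩ := Nat.dvd_factorial hn hle
    rw [hd, pow_mul]
    exact pow_mem (Subgroup.mem_inf.1 hxn).1 d
  refine hN.relIndex_ne_zero h.le ?_
  by_contra hsub
  obtain ⟨i, hiD, himax⟩ := Finset.exists_max_image (levels k N P \ levels k N K) id
    (Finset.sdiff_nonempty.2 hsub)
  obtain ⟨hiP, hiK⟩ := Finset.mem_sdiff.1 hiD
  obtain ⟨hi, t, htP, htN, ht⟩ := mem_levels.1 hiP
  have hind : (K ⊓ N (i + 1)).relIndex (P ⊓ N (i + 1)) ≠ 0 := by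
    refine hN.relIndex_inf_ne_zero (i + 1) (by omega) (fun j hj hjP => ?_) h.le
    by_contra hjK
    have := himax j (Finset.mem_sdiff.2 ⟨hjP, hjK⟩)
    simp only [id] at this
    omega
  let C : H₁ → ℕ → Prop := fun q M =>
    (∃ c : ℂ, ∀ w ∈ W, ρ (q * t ^ M * (q : G)⁻¹) w = c • ρ (t ^ M) w) ∨
    (∃ c : ℂ, ∀ w ∈ W, ρ (q * t ^ M * (q : G)⁻¹) w = c • ρ ((t ^ M)⁻¹) w)
  have hC : ∀ q, ∃ M, 0 < M ∧ C q M := by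
    intro q
    have hqP := hH₁ q.2
    have hnorm := hN.normal (i + 1)
    obtain ⟨M, hM, ε, hε, j, hj, he⟩ := hN.exists_conj_pow_eq hi hind
      (fun p hp j hj => Subgroup.mem_inf.2 ⟨h.conj_mem p hp j (Subgroup.mem_inf.1 hj).1,
        hnorm.conj_mem j (Subgroup.mem_inf.1 hj).2 p⟩) htP htN ht (p := q)
      ⟨1, one_pos, mul_mem (mul_mem hqP (pow_mem htP 1)) (inv_mem hqP)⟩
    have hjK := (Subgroup.mem_inf.1 hj).1
    refine ⟨M, hM, ?_⟩
    rcases hε with rfl | rfl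
    · refine Or.inl ⟨χ j, fun w hw => ?_⟩
      rw [he, zpow_one, ← apply_apply_eq, hw j hjK, map_smul]
    · refine Or.inr ⟨χ j, fun w hw => ?_⟩
      rw [he, zpow_neg_one, ← apply_apply_eq, hw j hjK, map_smul]
  have hCmul : ∀ q M s, 0 < s → C q M → C q (M * s) := by
    intro q M s _ hq
    have e : (q : G) * t ^ (M * s) * (q : G)⁻¹ = (q * t ^ M * (q : G)⁻¹) ^ s := by
      rw [conj_pow, pow_mul]
    rcases hq with ⟨c, hc⟩ | ⟨c, hc⟩
    · refine Or.inl ⟨c ^ s, fun w hw => ?_⟩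
      rw [e, apply_pow_eq_smul (hWP _ (pow_mem htP M)) hc s w hw, pow_mul]
    · refine Or.inr ⟨c ^ s, fun w hw => ?_⟩
      rw [e, apply_pow_eq_smul (hWP _ (inv_mem (pow_mem htP M))) hc s w hw, pow_mul, inv_pow]
  have : Fintype (H₁ ⧸ K.subgroupOf H₁) := Subgroup.fintypeOfIndexNeZero hKH₁
  let r : H₁ ⧸ K.subgroupOf H₁ → H₁ := Quotient.out
  obtain ⟨M, hM, hCM⟩ := exists_pos_of_forall_mul (Set.finite_range r)
    (fun q _ => hC q) hCmul
  set s := t ^ (M * m) with hs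
  have hsP : s ∈ P := pow_mem htP _
  have hone : ∀ q ∈ K, ∀ w ∈ W, ρ (q * s * q⁻¹) w = ρ s w :=
    fun q hq w hw => h.apply_conj_eq hq hsP hw
  have hcoef : ∀ x : H₁ ⧸ K.subgroupOf H₁, ∃ (n : ℕ) (b : ℂ), ((r x : G) ∈ K → n ≠ 0) ∧
      ∀ w ∈ W, ρ (r x * s * (r x : G)⁻¹) w = (n : ℂ) • ρ s w + b • ρ s⁻¹ w := by
    intro x
    by_cases hxK : (r x : G) ∈ K
    · refine ⟨1, 0, fun _ => one_ne_zero, fun w hw => ?_⟩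
      rw [hone _ hxK w hw, Nat.cast_one, one_smul, zero_smul, add_zero]
    rcases hCM (r x) ⟨x, rfl⟩ with ⟨c, hc⟩ | ⟨c, hc⟩
    · refine ⟨1, 0, fun _ => one_ne_zero, fun w hw => ?_⟩
      have h1 := apply_conj_pow_eq_smul (hWP _ (inv_mem (hH₁ (r x).2))) hc m
      have h2 : c ^ m = 1 := by
        have h3 := h1 w₀ hw₀W
        rw [h.apply_conj_eq (hmK _ (r x).2) (pow_mem htP M) hw₀W] at h3
        have h4 := weight_eq (apply_ne_zero ρ (t ^ M) hw₀) ((one_smul ℂ _).trans h3)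
        exact h4.symm
      have e : (r x : G) * s * (r x : G)⁻¹ = (r x * t ^ M * (r x : G)⁻¹) ^ m := by
        rw [conj_pow, hs, pow_mul]
      rw [e, apply_pow_eq_smul (hWP _ (pow_mem htP M)) hc m w hw, h2, ← pow_mul, ← hs,
        Nat.cast_one, one_smul, zero_smul, add_zero]
    · refine ⟨0, c ^ m, fun h0 => absurd h0 hxK, fun w hw => ?_⟩
      have e : (r x : G) * s * (r x : G)⁻¹ = (r x * t ^ M * (r x : G)⁻¹) ^ m := by
        rw [conj_pow, hs, pow_mul]
      rw [e, apply_pow_eq_smul (hWP _ (inv_mem (pow_mem htP M))) hc m w hw, inv_pow, ← pow_mul,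
        ← hs, Nat.cast_zero, zero_smul, zero_add]
  choose n b hn hnb using hcoef
  let T : Module.End ℂ V := ∑ x, ρ (r x * s * (r x : G)⁻¹)
  have hT : ∀ w, T w = ∑ x, ρ (r x * s * (r x : G)⁻¹) w := fun w => by
    simp [T, LinearMap.sum_apply]
  have hTW : ∀ w ∈ W, T w = ((∑ x, n x : ℕ) : ℂ) • ρ s w + (∑ x, b x) • ρ s⁻¹ w := by
    intro w hw
    rw [hT, Finset.sum_congr rfl fun x _ => hnb x w hw, Finset.sum_add_distrib, Nat.cast_sum,
      Finset.sum_smul, Finset.sum_smul]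
  have hα : ((∑ x, n x : ℕ) : ℂ) ≠ 0 := by
    rw [Nat.cast_ne_zero]
    have h1 : (r ((1 : H₁) : H₁ ⧸ K.subgroupOf H₁) : G) ∈ K := by
      have h2 : ((r ((1 : H₁) : H₁ ⧸ K.subgroupOf H₁) : H₁) : H₁ ⧸ K.subgroupOf H₁) = (1 : H₁) :=
        Quotient.out_eq _
      rw [QuotientGroup.eq, mul_one] at h2
      exact inv_mem_iff.1 h2
    intro h0
    exact hn _ h1 (Finset.sum_eq_zero_iff.1 h0 _ (Finset.mem_univ _))
  have hTY : ∀ y ∈ W ⊓ weightVectors ρ H₁ ψ₁, T y ∈ W ⊓ weightVectors ρ H₁ ψ₁ := by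
    rintro y ⟨hyW, hyH⟩
    refine ⟨?_, fun a ha => ?_⟩
    · rw [hT]
      refine sum_mem fun x _ => hWP _ ?_ y hyW
      exact mul_mem (mul_mem (hH₁ (r x).2) hsP) (inv_mem (hH₁ (r x).2))
    · rw [hT, map_sum, Finset.smul_sum]
      refine Fintype.sum_equiv (MulAction.toPerm (⟨a, ha⟩ : H₁)) _ _ fun x => ?_
      have h1 : ((r ((⟨a, ha⟩ : H₁) • x) : H₁) : H₁ ⧸ K.subgroupOf H₁) =
          ((⟨a, ha⟩ * r x : H₁) : H₁ ⧸ K.subgroupOf H₁) := by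
        have h2 : ((r x : H₁) : H₁ ⧸ K.subgroupOf H₁) = x := Quotient.out_eq x
        have h3 : ((r ((⟨a, ha⟩ : H₁) • x) : H₁) : H₁ ⧸ K.subgroupOf H₁) = (⟨a, ha⟩ : H₁) • x :=
          Quotient.out_eq _
        rw [h3, ← smul_eq_mul, ← MulAction.Quotient.smul_coe, h2]
      rw [QuotientGroup.eq, Subgroup.mem_subgroupOf] at h1
      set d : G := ((r ((⟨a, ha⟩ : H₁) • x) : H₁) : G) with hd
      have hdP : d ∈ P := hH₁ (r _).2
      have h4 : d⁻¹ * (a * r x) ∈ K := by simpa using h1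
      have e1 : a * (r x * s * (r x : G)⁻¹) = d * (d⁻¹ * (a * r x) * s * (d⁻¹ * (a * r x))⁻¹) *
          d⁻¹ * a := by group
      have e2 : MulAction.toPerm (⟨a, ha⟩ : H₁) x = (⟨a, ha⟩ : H₁) • x := rfl
      rw [apply_apply_eq, e1, ← apply_apply_eq, hyH a ha, map_smul, ← apply_apply_eq,
        ← apply_apply_eq, hone _ h4 _ (hWP _ (inv_mem hdP) y hyW), apply_apply_eq,
        apply_apply_eq, e2, ← hd]
  have hnt : Nontrivial ↥(W ⊓ weightVectors ρ H₁ ψ₁) := Submodule.nontrivial_iff_ne_bot.2 hne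
  obtain ⟨μ, hμ⟩ := Module.End.exists_eigenvalue (T.restrict hTY)
  obtain ⟨⟨y, hyW, hyH⟩, hy⟩ := hμ.exists_hasEigenvector
  have hTy : T y = μ • y := congrArg Subtype.val hy.apply_eq_smul
  have hy0 : y ≠ 0 := fun h0 => hy.2 (Subtype.ext h0)
  set α := ((∑ x, n x : ℕ) : ℂ)
  set β := ∑ x, b x
  obtain ⟨w, hw, hw0, c, hc⟩ := exists_eigenvector_of_aeval (hWP s hsP) hyW hy0 _
    (Polynomial.C α * Polynomial.X ^ 2 - Polynomial.C μ * Polynomial.X + Polynomial.C β) rfl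
    (fun h0 => hα (by simpa using congrArg (fun p => p.coeff 2) h0))
    (by
      have h1 := hTW y hyW
      rw [hTy] at h1
      have h2 := congrArg (ρ s) h1
      rw [map_smul, map_add, map_smul, map_smul, apply_inv_apply] at h2
      simp [Module.algebraMap_end_apply, pow_two, h2])
  exact h.false_of_eigenvector hi hiK htN ht (Nat.mul_pos hM hm) hw hw0 hc

end MaximalWeight

end Commensurability

section Extension

variable {G : Type*} [Group G] {V : Type*} [AddCommGroup V] [Module ℂ V]

theorem exists_weightVectors_lineStab (ρ : G →* Module.End ℂ V) (v : V) :
    ∃ χ : G → ℂ, v ∈ weightVectors ρ (lineStab ρ v) χ := by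
  have hχ : ∀ g, ∃ c : ℂ, g ∈ lineStab ρ v → ρ g v = c • v := by
    intro g
    by_cases hg : g ∈ lineStab ρ v
    · obtain ⟨c, hc⟩ := hg
      exact ⟨c, fun _ => hc⟩
    · exact ⟨0, fun h => absurd h hg⟩
  choose χ hχ using hχ
  exact ⟨χ, hχ⟩

theorem weight_ne_zero {ρ : G →* Module.End ℂ V} {H : Subgroup G} {χ : G → ℂ} {v : V}
    (hv0 : v ≠ 0) (hv : v ∈ weightVectors ρ H χ) {a : G} (ha : a ∈ H) : χ a ≠ 0 := by
  intro h0
  have := hv a ha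
  rw [h0, zero_smul] at this
  exact apply_ne_zero ρ a hv0 this

theorem weight_mul {ρ : G →* Module.End ℂ V} {H : Subgroup G} {χ : G → ℂ} {v : V}
    (hv0 : v ≠ 0) (hv : v ∈ weightVectors ρ H χ) {a b : G} (ha : a ∈ H) (hb : b ∈ H) :
    χ (a * b) = χ a * χ b := by
  refine weight_eq hv0 ?_
  rw [← hv _ (mul_mem ha hb), ← apply_apply_eq, hv b hb, map_smul, hv a ha, smul_smul, mul_comm]

/-- A weight restricts to a character. -/
theorem exists_character {ρ : G →* Module.End ℂ V} {H : Subgroup G} {ψ : G → ℂ}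
    (hne : weightVectors ρ H ψ ≠ ⊥) : ∃ χ : H →* ℂˣ, ∀ x : H, ψ x = χ x := by
  obtain ⟨v, hv, hv0⟩ := (Submodule.ne_bot_iff _).1 hne
  refine ⟨MonoidHom.mk' (fun x => Units.mk0 (ψ x) (weight_ne_zero hv0 hv x.2)) fun a b => ?_,
    fun x => rfl⟩
  ext
  exact weight_mul hv0 hv a.2 b.2

theorem weight_conj {ρ : G →* Module.End ℂ V} {H : Subgroup G} {χ : G → ℂ} {v : V}
    (hv0 : v ≠ 0) (hv : v ∈ weightVectors ρ H χ) {a b : G} (ha : a ∈ H) (hb : b ∈ H) :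
    χ (a⁻¹ * b * a) = χ b := by
  have h1 := weight_mul hv0 hv (mul_mem (mul_mem (inv_mem ha) hb) ha) (inv_mem ha)
  have h2 := weight_mul hv0 hv (inv_mem ha) hb
  rw [mul_inv_cancel_right, h2, mul_comm] at h1
  exact (mul_right_cancel₀ (weight_ne_zero hv0 hv (inv_mem ha)) h1).symm

/-- A weight of a subgroup `K` that is invariant under `P`, with `K` of finite index in `P`,
extends to a weight of a subgroup `H` of `P` for which no element of `P` outside `H` conjugates
the weight to a compatible one. -/
theorem IsCyclicChain.exists_extension {k : ℕ} {N : ℕ → Subgroup G} (hN : IsCyclicChain k N)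
    (ρ : G →* Module.End ℂ V) (n : ℕ) : ∀ (K P : Subgroup G) (χ : G → ℂ), K.relIndex P = n →
    n ≠ 0 → K ≤ P → (∀ p ∈ P, ∀ x ∈ K, p * x * p⁻¹ ∈ K) →
    (∀ p ∈ P, ∀ x ∈ K, χ (p⁻¹ * x * p) = χ x) → weightVectors ρ K χ ≠ ⊥ →
    ∃ (H : Subgroup G) (ψ : G → ℂ), K ≤ H ∧ H ≤ P ∧ (∀ x ∈ K, ψ x = χ x) ∧
      weightVectors ρ H ψ ≠ ⊥ ∧
      ∀ p ∈ P, (∀ x ∈ H, p⁻¹ * x * p ∈ H → ψ (p⁻¹ * x * p) = ψ x) → p ∈ H := by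
  induction n using Nat.strong_induction_on with
  | _ n ih =>
  classical
  intro K P χ hn hn0 hKP hconj hχ hne
  by_cases hPK : P ≤ K
  · exact ⟨K, χ, le_rfl, hKP, fun _ _ => rfl, hne, fun p hp _ => hPK hp⟩
  have hex : ∃ j, P ⊓ N j ≤ K := ⟨k + 1, by rw [hN.bot, inf_bot_eq]; exact bot_le⟩
  obtain ⟨i, hi, hiK, hiK'⟩ : ∃ i ≤ k, ¬ P ⊓ N i ≤ K ∧ P ⊓ N (i + 1) ≤ K := by
    have h0 : Nat.find hex ≠ 0 := by
      intro h0
      have := Nat.find_spec hex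
      rw [h0, hN.top, inf_top_eq] at this
      exact hPK this
    obtain ⟨i, hi⟩ := Nat.exists_eq_succ_of_ne_zero h0
    refine ⟨i, ?_, Nat.find_min hex (by omega), ?_⟩
    · have : Nat.find hex ≤ k + 1 := Nat.find_min' hex (by rw [hN.bot, inf_bot_eq]; exact bot_le)
      omega
    · have := Nat.find_spec hex
      rwa [hi] at this
  obtain ⟨y, hyP, hyN, hy⟩ := hN.exists_generator hi P
  have hyK : y ∉ K := by
    intro hyK
    refine hiK fun p hp => ?_
    obtain ⟨n, q, hq, hqN, rfl⟩ := hy p (Subgroup.mem_inf.1 hp).1 (Subgroup.mem_inf.1 hp).2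
    exact mul_mem (zpow_mem hyK n) (hiK' (Subgroup.mem_inf.2 ⟨hq, hqN⟩))
  have hfi : K.relIndex P ≠ 0 := hn ▸ hn0
  obtain ⟨w, hw, hw0⟩ := Submodule.exists_mem_ne_zero_of_ne_bot hne
  obtain ⟨m, hm, -, hym⟩ := Subgroup.exists_pow_mem_of_relIndex_ne_zero hfi hyP
  have hymK := (Subgroup.mem_inf.1 hym).1
  obtain ⟨v, hv, hv0, c, hc⟩ := exists_eigenvector_of_aeval (f := ρ y) (W := weightVectors ρ K χ)
    (by
      intro u hu x hx
      have : ρ x (ρ y u) = ρ y (ρ (y⁻¹ * x * y) u) := by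
        rw [apply_apply_eq, apply_apply_eq]; congr 2; group
      rw [this, hu _ (by simpa using hconj _ (inv_mem hyP) x hx), map_smul, hχ y hyP x hx])
    hw hw0 _ (Polynomial.X ^ m - Polynomial.C (χ (y ^ m))) rfl
    (Polynomial.X_pow_sub_C_ne_zero hm _)
    (by
      rw [map_sub, map_pow, Polynomial.aeval_X, Polynomial.aeval_C, ← map_pow,
        LinearMap.sub_apply, hw _ hymK, Module.algebraMap_end_apply, sub_self])
  obtain ⟨χ₁, hχ₁⟩ := exists_weightVectors_lineStab ρ v
  have hni := hN.normal i
  let K₁ := (K ⊔ N i) ⊓ P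
  have hK₁P : K₁ ≤ P := inf_le_right
  have hKK₁ : K ≤ K₁ := le_inf le_sup_left hKP
  have hyK₁ : y ∈ K₁ := Subgroup.mem_inf.2 ⟨Subgroup.mem_sup_right hyN, hyP⟩
  have hK₁conj : ∀ p ∈ P, ∀ x ∈ K₁, p * x * p⁻¹ ∈ K₁ := by
    intro p hp x hx
    obtain ⟨hxs, hxP⟩ := Subgroup.mem_inf.1 hx
    refine Subgroup.mem_inf.2 ⟨?_, mul_mem (mul_mem hp hxP) (inv_mem hp)⟩
    obtain ⟨a, ha, b, hb, rfl⟩ := Subgroup.mem_sup_of_normal_right.1 hxs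
    have e : p * (a * b) * p⁻¹ = p * a * p⁻¹ * (p * b * p⁻¹) := by group
    rw [e]
    exact Subgroup.mul_mem_sup (hconj p hp a ha) (hni.conj_mem b hb p)
  have hK₁v : K₁ ≤ lineStab ρ v := by
    intro x hx
    obtain ⟨hxs, hxP⟩ := Subgroup.mem_inf.1 hx
    obtain ⟨a, ha, b, hb, rfl⟩ := Subgroup.mem_sup_of_normal_right.1 hxs
    have hbP : b ∈ P := (Subgroup.mul_mem_cancel_left P (hKP ha)).1 hxP
    obtain ⟨n, q, hq, hqN, rfl⟩ := hy b hbP hb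
    exact mul_mem (le_lineStab hv ha) (mul_mem (zpow_mem (mem_lineStab_of_smul hc) n)
      (le_lineStab hv (hiK' (Subgroup.mem_inf.2 ⟨hq, hqN⟩))))
  have hvK₁ := weightVectors_anti ρ hK₁v χ₁ hχ₁
  have hχχ₁ : ∀ x ∈ K, χ₁ x = χ x := by
    intro x hx
    refine weight_eq hv0 ?_
    rw [← hv x hx, ← hvK₁ x (hKK₁ hx)]
  let P₁ : Subgroup G :=
    { carrier := {p | p ∈ P ∧ ∀ x ∈ K₁, χ₁ (p⁻¹ * x * p) = χ₁ x}
      one_mem' := ⟨one_mem P, fun x _ => by simp⟩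
      mul_mem' := by
        rintro a b ⟨ha, ha'⟩ ⟨hb, hb'⟩
        refine ⟨mul_mem ha hb, fun x hx => ?_⟩
        have h1 := hb' (a⁻¹ * x * a) (by simpa using hK₁conj _ (inv_mem ha) x hx)
        rw [ha' x hx] at h1
        rw [← h1]
        congr 1
        group
      inv_mem' := by
        rintro a ⟨ha, ha'⟩
        refine ⟨inv_mem ha, fun x hx => ?_⟩
        have h1 := ha' _ (hK₁conj a ha x hx)
        rw [inv_inv, ← h1]
        congr 1
        group }
  have hP₁P : P₁ ≤ P := fun p hp => hp.1
  have hK₁P₁ : K₁ ≤ P₁ := fun p hp => ⟨hK₁P hp, fun x hx => weight_conj hv0 hvK₁ hp hx⟩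
  have hmul := Subgroup.relIndex_mul_relIndex K K₁ P hKK₁ hK₁P
  have h1 : K.relIndex K₁ ≠ 1 := fun h0 => hyK (Subgroup.relIndex_eq_one.1 h0 hyK₁)
  have h2 : K₁.relIndex P ≠ 0 := right_ne_zero_of_mul (hmul ▸ hfi)
  have h3 : K.relIndex K₁ ≠ 0 := left_ne_zero_of_mul (hmul ▸ hfi)
  have h4 : K₁.relIndex P₁ ≤ K₁.relIndex P := Subgroup.relIndex_le_of_le_right hP₁P h2
  have h5 : K₁.relIndex P₁ ≠ 0 := fun h0 =>
    h2 (Subgroup.relIndex_eq_zero_of_le_right hP₁P h0)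
  have hlt : K₁.relIndex P₁ < n := by
    have : 2 * K₁.relIndex P ≤ K.relIndex P := by
      rw [← hmul]; exact Nat.mul_le_mul_right _ (by omega)
    omega
  obtain ⟨H, ψ, hK₁H, hHP₁, hψ, hne', hH⟩ := ih _ hlt K₁ P₁ χ₁ rfl h5 hK₁P₁
    (fun p hp => hK₁conj p (hP₁P hp)) (fun p hp => hp.2)
    ((Submodule.ne_bot_iff _).2 ⟨v, hvK₁, hv0⟩)
  refine ⟨H, ψ, hKK₁.trans hK₁H, hHP₁.trans hP₁P,
    fun x hx => (hψ x (hKK₁ hx)).trans (hχχ₁ x hx), hne', fun p hp hpH => ?_⟩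
  refine hH p ⟨hp, fun x hx => ?_⟩ hpH
  have h6 : p⁻¹ * x * p ∈ K₁ := by simpa using hK₁conj _ (inv_mem hp) x hx
  rw [← hψ _ h6, ← hψ x hx]
  exact hpH x (hK₁H hx) (hK₁H h6)

end Extension

section Induced

variable {G : Type*} [Group G]

open Classical in
/-- The extension of a character of `H` to `G` by zero. -/
noncomputable def extendByZero {H : Subgroup G} (χ : H →* ℂˣ) (g : G) : ℂ :=
  if hg : g ∈ H then χ ⟨g, hg⟩ else 0

variable {H : Subgroup G} {χ : H →* ℂˣ}

theorem extendByZero_of_mem {g : G} (hg : g ∈ H) : extendByZero χ g = χ ⟨g, hg⟩ := dif_pos hg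

theorem extendByZero_of_notMem {g : G} (hg : g ∉ H) : extendByZero χ g = 0 := dif_neg hg

theorem extendByZero_ne_zero {g : G} (hg : g ∈ H) : extendByZero χ g ≠ 0 := by
  rw [extendByZero_of_mem hg]; exact Units.ne_zero _

theorem mem_of_extendByZero_ne_zero {g : G} (hg : extendByZero χ g ≠ 0) : g ∈ H := by
  by_contra h
  exact hg (extendByZero_of_notMem h)

theorem extendByZero_one : extendByZero χ 1 = 1 := by
  rw [extendByZero_of_mem (one_mem H)]
  exact congrArg Units.val (map_one χ)

theorem extendByZero_mul_left {a : G} (ha : a ∈ H) (b : G) :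
    extendByZero χ (a * b) = extendByZero χ a * extendByZero χ b := by
  by_cases hb : b ∈ H
  · rw [extendByZero_of_mem ha, extendByZero_of_mem hb, extendByZero_of_mem (mul_mem ha hb),
      ← Units.val_mul, ← map_mul]
    rfl
  · rw [extendByZero_of_notMem hb, mul_zero, extendByZero_of_notMem]
    rwa [Subgroup.mul_mem_cancel_left H ha]

theorem extendByZero_mul_right (a : G) {b : G} (hb : b ∈ H) :
    extendByZero χ (a * b) = extendByZero χ a * extendByZero χ b := by
  by_cases ha : a ∈ H
  · exact extendByZero_mul_left ha b
  · rw [extendByZero_of_notMem ha, zero_mul, extendByZero_of_notMem]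
    rwa [Subgroup.mul_mem_cancel_right H hb]

variable (χ)

/-- The embedding of `IndChar H χ` in the functions on `G`, defined on the group algebra. -/
noncomputable def indFunction : MonoidAlgebra ℂ G →ₗ[ℂ] (G → ℂ) :=
  Finsupp.linearCombination ℂ (fun g x => extendByZero χ (x⁻¹ * g)) ∘ₗ
    (MonoidAlgebra.coeffLinearEquiv ℂ).toLinearMap

theorem indFunction_single (g : G) (a : ℂ) (x : G) :
    indFunction χ (MonoidAlgebra.single g a) x = a * extendByZero χ (x⁻¹ * g) := by
  simp [indFunction]

/-- The left ideal whose quotient is `IndChar H χ`. -/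
noncomputable abbrev indIdeal : Submodule (MonoidAlgebra ℂ G) (MonoidAlgebra ℂ G) :=
  Submodule.span (MonoidAlgebra ℂ G)
    {x : MonoidAlgebra ℂ G | ∃ h : H,
      x = MonoidAlgebra.single (h : G) (1 : ℂ) - (χ h : ℂ) • (1 : MonoidAlgebra ℂ G)}

theorem indFunction_single_mul (g : G) (r : MonoidAlgebra ℂ G) (x : G) :
    indFunction χ (MonoidAlgebra.single g 1 * r) x = indFunction χ r (g⁻¹ * x) := by
  induction r using MonoidAlgebra.induction_linear with
  | zero => simp
  | add r s hr hs => rw [mul_add, map_add, map_add, Pi.add_apply, Pi.add_apply, hr, hs]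
  | single b a =>
    rw [MonoidAlgebra.single_mul_single, indFunction_single, indFunction_single, one_mul,
      mul_inv_rev, inv_inv, mul_assoc]

theorem indFunction_mul_single (r : MonoidAlgebra ℂ G) {h : G} (hh : h ∈ H) :
    indFunction χ (r * MonoidAlgebra.single h 1) = extendByZero χ h • indFunction χ r := by
  ext x
  induction r using MonoidAlgebra.induction_linear with
  | zero => simp
  | add r s hr hs =>
    rw [add_mul, map_add, map_add, Pi.add_apply, hr, hs, smul_add, Pi.add_apply]
  | single b a =>
    rw [MonoidAlgebra.single_mul_single, Pi.smul_apply, indFunction_single, indFunction_single,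
      mul_one, ← mul_assoc, extendByZero_mul_right _ hh, smul_eq_mul]
    ring

theorem indFunction_mul (r : MonoidAlgebra ℂ G) {h : G} (hh : h ∈ H) (x : G) :
    indFunction χ r (x * h) = extendByZero χ h⁻¹ * indFunction χ r x := by
  induction r using MonoidAlgebra.induction_linear with
  | zero => simp
  | add r s hr hs => rw [map_add, Pi.add_apply, Pi.add_apply, hr, hs, mul_add]
  | single b a =>
    rw [indFunction_single, indFunction_single, mul_inv_rev, mul_assoc,
      extendByZero_mul_left (inv_mem hh)]
    ring

theorem indFunction_eq_zero_of_mem {r : MonoidAlgebra ℂ G} (hr : r ∈ indIdeal χ) :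
    indFunction χ r = 0 := by
  induction hr using Submodule.span_induction with
  | zero => simp
  | add x y _ _ hx hy => rw [map_add, hx, hy, add_zero]
  | mem x hx =>
    obtain ⟨h, rfl⟩ := hx
    have := indFunction_mul_single χ 1 h.2
    rw [one_mul, extendByZero_of_mem h.2] at this
    rw [map_sub, map_smul, this, sub_self]
  | smul s x _ hx =>
    ext y
    rw [smul_eq_mul, Pi.zero_apply]
    induction s using MonoidAlgebra.induction_linear with
    | zero => simp
    | add r s hr hs => rw [add_mul, map_add, Pi.add_apply, hr, hs, add_zero]
    | single b a =>
      have : MonoidAlgebra.single b a = a • MonoidAlgebra.single b (1 : ℂ) := by simp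
      rw [this, smul_mul_assoc, map_smul, Pi.smul_apply, indFunction_single_mul, hx, Pi.zero_apply,
        smul_zero]

theorem single_sub_mem_indIdeal (g : G) {h : G} (hh : h ∈ H) (a : ℂ) :
    MonoidAlgebra.single (g * h) a - MonoidAlgebra.single g (a * extendByZero χ h) ∈
      indIdeal χ := by
  have h1 := Submodule.smul_mem (indIdeal χ) (MonoidAlgebra.single g a)
    (Submodule.subset_span ⟨⟨h, hh⟩, rfl⟩)
  rw [smul_eq_mul, mul_sub, MonoidAlgebra.single_mul_single, mul_one, mul_smul_comm, mul_one,
    MonoidAlgebra.smul_single, smul_eq_mul, mul_comm _ a] at h1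
  rwa [extendByZero_of_mem hh]

/-- Modulo the left ideal, every element is supported on coset representatives. -/
theorem exists_sub_mem_indIdeal (r : MonoidAlgebra ℂ G) : ∃ s : MonoidAlgebra ℂ G,
    r - s ∈ indIdeal χ ∧ ∀ x : G, s.coeff x ≠ 0 →
      x = (x : G ⧸ H).out ∧ s.coeff x = indFunction χ r x := by
  classical
  suffices h : ∃ s : MonoidAlgebra ℂ G, r - s ∈ indIdeal χ ∧ ∀ x : G,
      s.coeff x = if x = (x : G ⧸ H).out then indFunction χ r x else 0 by
    obtain ⟨s, hs, hsx⟩ := h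
    refine ⟨s, hs, fun x hx => ?_⟩
    rw [hsx] at hx ⊢
    by_cases hxo : x = (x : G ⧸ H).out
    · rw [if_pos hxo]; exact ⟨hxo, rfl⟩
    · rw [if_neg hxo] at hx; exact absurd rfl hx
  induction r using MonoidAlgebra.induction_linear with
  | zero => exact ⟨0, by simp, by simp⟩
  | add r₁ r₂ h₁ h₂ =>
    obtain ⟨s₁, hs₁, hx₁⟩ := h₁
    obtain ⟨s₂, hs₂, hx₂⟩ := h₂
    refine ⟨s₁ + s₂, by rw [add_sub_add_comm]; exact add_mem hs₁ hs₂, fun x => ?_⟩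
    rw [MonoidAlgebra.coeff_add, Finsupp.add_apply, hx₁, hx₂, map_add, Pi.add_apply]
    split_ifs <;> simp
  | single g a =>
    set o := (g : G ⧸ H).out with ho
    have hog : (o : G ⧸ H) = g := Quotient.out_eq _
    have hmem : o⁻¹ * g ∈ H := QuotientGroup.eq.1 hog
    refine ⟨MonoidAlgebra.single o (a * extendByZero χ (o⁻¹ * g)), ?_, fun x => ?_⟩
    · have := single_sub_mem_indIdeal χ o hmem a
      rwa [mul_inv_cancel_left] at this
    · rw [MonoidAlgebra.coeff_single, Finsupp.single_apply, indFunction_single]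
      by_cases hx : o = x
      · subst hx
        rw [if_pos rfl, if_pos (by rw [hog])]
      · rw [if_neg hx]
        split_ifs with hxo
        · rw [extendByZero_of_notMem, mul_zero]
          intro h0
          refine hx ?_
          rw [hxo, ho, QuotientGroup.eq.2 h0]
        · rfl

theorem exists_smul_one_sub_mem_indIdeal {r : MonoidAlgebra ℂ G}
    (hr : ∀ x ∉ H, indFunction χ r x = 0) : ∃ c : ℂ, r - c • 1 ∈ indIdeal χ := by
  classical
  obtain ⟨s, hs, hsx⟩ := exists_sub_mem_indIdeal χ r
  set o := ((1 : G) : G ⧸ H).out with ho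
  have hoH : o ∈ H := by
    have : (o : G ⧸ H) = (1 : G) := Quotient.out_eq _
    rw [QuotientGroup.eq, mul_one] at this
    exact inv_mem_iff.1 this
  have hs1 : s = MonoidAlgebra.single o (s.coeff o) := by
    apply MonoidAlgebra.coeff_injective
    ext x
    rw [MonoidAlgebra.coeff_single, Finsupp.single_apply]
    split_ifs with hx
    · rw [hx]
    · by_contra h0
      obtain ⟨h1, h2⟩ := hsx x h0
      refine hx ?_
      have hxH : x ∈ H := by
        by_contra hxH
        exact h0 (h2.trans (hr x hxH))
      rw [h1, ho]
      congr 1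
      rw [QuotientGroup.eq]
      simpa using hxH
  refine ⟨s.coeff o * extendByZero χ o, ?_⟩
  have h3 := single_sub_mem_indIdeal χ 1 hoH (s.coeff o)
  rw [one_mul, ← hs1] at h3
  have := add_mem hs h3
  rw [sub_add_sub_cancel] at this
  rwa [MonoidAlgebra.one_def, MonoidAlgebra.smul_single, smul_eq_mul, mul_one]

/-- Mackey's criterion: if no element outside `H` both commensurates `H` and is compatible with
`χ`, then the induced representation is Schur irreducible. -/
theorem schurIrreducible_indChar
    (hH : ∀ g : G, (∀ h ∈ H, ∃ n : ℕ, 0 < n ∧ g⁻¹ * h ^ n * g ∈ H) →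
      (∀ h ∈ H, g⁻¹ * h * g ∈ H → extendByZero χ (g⁻¹ * h * g) = extendByZero χ h) → g ∈ H) :
    SchurIrreducible G (IndChar H χ) := by
  classical
  intro f
  obtain ⟨r, hr⟩ := Submodule.mkQ_surjective _ (f ((indIdeal χ).mkQ 1))
  have hinv : ∀ h ∈ H, ∀ x, indFunction χ r (h⁻¹ * x) = extendByZero χ h * indFunction χ r x := by
    intro h hh x
    have h1 : (indIdeal χ).mkQ (MonoidAlgebra.single h 1 * r - extendByZero χ h • r) = 0 := by
      have h2 : (indIdeal χ).mkQ (MonoidAlgebra.single h 1 - extendByZero χ h • 1) = 0 := by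
        rw [Submodule.mkQ_apply, Submodule.Quotient.mk_eq_zero, extendByZero_of_mem hh]
        exact Submodule.subset_span ⟨⟨h, hh⟩, rfl⟩
      have h3 : MonoidAlgebra.single h 1 * r - extendByZero χ h • r =
          (MonoidAlgebra.single h 1 - extendByZero χ h • 1 : MonoidAlgebra ℂ G) • r := by
        rw [smul_eq_mul, sub_mul, smul_mul_assoc, one_mul]
      rw [h3, map_smul, hr, ← map_smul, ← map_smul, smul_eq_mul, mul_one, h2, map_zero]
    rw [Submodule.mkQ_apply, Submodule.Quotient.mk_eq_zero] at h1
    have h4 := congrFun (indFunction_eq_zero_of_mem χ h1) x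
    rw [map_sub, map_smul, Pi.sub_apply, Pi.smul_apply, indFunction_single_mul, Pi.zero_apply,
      sub_eq_zero, smul_eq_mul] at h4
    exact h4
  have hsupp : ∀ x, indFunction χ r x ≠ 0 →
      (x : G ⧸ H) ∈ r.coeff.support.image (fun g : G => (g : G ⧸ H)) := by
    intro x hx
    have h1 : indFunction χ r x = ∑ g ∈ r.coeff.support, r.coeff g * extendByZero χ (x⁻¹ * g) := by
      simp [indFunction, Finsupp.linearCombination_apply, Finsupp.sum, Finset.sum_apply]
    rw [h1] at hx
    obtain ⟨g, hg, hne⟩ := Finset.exists_ne_zero_of_sum_ne_zero hx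
    refine Finset.mem_image.2 ⟨g, hg, ?_⟩
    exact (QuotientGroup.eq.2 (mem_of_extendByZero_ne_zero (right_ne_zero_of_mul hne))).symm
  obtain ⟨c, hc⟩ := exists_smul_one_sub_mem_indIdeal χ (r := r) (fun g hg => by
    by_contra hne
    refine hg (hH g (fun h hh => ?_) fun h hh hgh => ?_)
    · have hmem : ∀ n : ℕ, (((h ^ n)⁻¹ * g : G) : G ⧸ H) ∈
          r.coeff.support.image (fun g : G => (g : G ⧸ H)) := fun n => hsupp _ (by
        rw [hinv _ (pow_mem hh n)]
        exact mul_ne_zero (extendByZero_ne_zero (pow_mem hh n)) hne)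
      obtain ⟨a, b, hab, he⟩ := Finite.exists_ne_map_eq_of_infinite
        (fun n : ℕ => (⟨_, hmem n⟩ : r.coeff.support.image (fun g : G => (g : G ⧸ H))))
      wlog hlt : a < b generalizing a b
      · exact this b a hab.symm he.symm (by omega)
      obtain ⟨d, rfl⟩ := Nat.exists_eq_add_of_le hlt.le
      have h1 : (((h ^ (a + d))⁻¹ * g : G) : G ⧸ H) = ((h ^ a)⁻¹ * g : G) :=
        (congrArg Subtype.val he).symm
      rw [QuotientGroup.eq] at h1
      refine ⟨d, by omega, ?_⟩
      have e : ((h ^ (a + d))⁻¹ * g)⁻¹ * ((h ^ a)⁻¹ * g) = g⁻¹ * h ^ d * g := by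
        rw [add_comm a d, pow_add]; group
      rwa [e] at h1
    · have h1 := hinv _ (inv_mem hh) g
      have h2 := indFunction_mul χ r hgh g
      have e : g * (g⁻¹ * h * g) = h⁻¹⁻¹ * g := by group
      rw [e, h1] at h2
      have h3 := mul_right_cancel₀ hne h2
      have h4 : ∀ x ∈ H, extendByZero χ x * extendByZero χ x⁻¹ = 1 := fun x hx => by
        rw [← extendByZero_mul_left hx, mul_inv_cancel, extendByZero_one]
      have h5 := h4 h hh
      rw [h3, ← h4 _ hgh] at h5
      exact (mul_right_cancel₀ (extendByZero_ne_zero (inv_mem hgh)) h5).symm)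
  refine ⟨c, fun v => ?_⟩
  obtain ⟨a, rfl⟩ := Submodule.mkQ_surjective _ v
  have h1 : f ((indIdeal χ).mkQ 1) = c • (indIdeal χ).mkQ 1 := by
    rw [← hr, ← sub_eq_zero]
    exact (Submodule.Quotient.mk_eq_zero _).2 hc
  have h2 : (indIdeal χ).mkQ a = a • (indIdeal χ).mkQ 1 := by
    rw [← map_smul, smul_eq_mul, mul_one]
  change f ((indIdeal χ).mkQ a) = c • (indIdeal χ).mkQ a
  rw [h2, map_smul, h1, smul_comm]

end Induced

section Representation

variable (G : Type*) [Group G] (V : Type*) [AddCommGroup V] [Module ℂ V]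
  [Module (MonoidAlgebra ℂ G) V] [IsScalarTower ℂ (MonoidAlgebra ℂ G) V]

/-- The action of a group on a module over its group algebra. -/
noncomputable def groupAction : G →* Module.End ℂ V where
  toFun g :=
    { toFun := fun v => MonoidAlgebra.single g (1 : ℂ) • v
      map_add' := fun v w => smul_add _ v w
      map_smul' := fun c v => smul_comm _ c v }
  map_one' := by
    ext v
    exact one_smul (MonoidAlgebra ℂ G) v
  map_mul' a b := by
    ext v
    change MonoidAlgebra.single (a * b) (1 : ℂ) • v =
      MonoidAlgebra.single a (1 : ℂ) • MonoidAlgebra.single b (1 : ℂ) • v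
    rw [smul_smul, MonoidAlgebra.single_mul_single, one_mul]

variable {G V}

theorem eq_top_of_groupAction_mem [IsSimpleModule (MonoidAlgebra ℂ G) V] (U : Submodule ℂ V)
    (hU : ∀ g : G, ∀ u ∈ U, groupAction G V g u ∈ U) (hne : U ≠ ⊥) : U = ⊤ := by
  let U' : Submodule (MonoidAlgebra ℂ G) V :=
    { U.toAddSubmonoid with
      smul_mem' := by
        intro r u hu
        change r • u ∈ U
        induction r using MonoidAlgebra.induction_linear with
        | zero => rw [zero_smul]; exact zero_mem U
        | add r s hr hs => rw [add_smul]; exact add_mem hr hs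
        | single g a =>
          have h : MonoidAlgebra.single g a = a • MonoidAlgebra.single g (1 : ℂ) := by simp
          rw [h, smul_assoc]
          exact U.smul_mem a (hU g u hu) }
  have hmem : ∀ v, v ∈ U' ↔ v ∈ U := fun _ => Iff.rfl
  obtain h | h := eq_bot_or_eq_top U'
  · refine absurd ((Submodule.eq_bot_iff U).2 fun v hv => ?_) hne
    rwa [← hmem, h, Submodule.mem_bot] at hv
  · refine (Submodule.eq_top_iff').2 fun v => ?_
    rw [← hmem, h]
    exact Submodule.mem_top

theorem weightSpace_eq_weightVectors {H : Subgroup G} {χ : H →* ℂˣ} {ψ : G → ℂ}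
    (h : ∀ x : H, ψ x = χ x) : weightSpace H χ V = weightVectors (groupAction G V) H ψ := by
  ext v
  rw [mem_weightVectors]
  refine ⟨fun hv g hg => ?_, fun hv g => ?_⟩
  · rw [h ⟨g, hg⟩]
    exact hv ⟨g, hg⟩
  · rw [← h]
    exact hv g g.2

end Representation

/-- For an irreducible representation of finite weight of a supersolvable group there
is a pair `(H', χ')` whose weight space is nonzero and for which `Ind_{H'}^G χ'` is
Schur irreducible. -/
theorem exists_schurIrreducible_indChar (G : Type*) [Group G]
    (hG : IsSupersolvable G) (V : Type*) [AddCommGroup V] [Module ℂ V]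
    [Module (MonoidAlgebra ℂ G) V] [IsScalarTower ℂ (MonoidAlgebra ℂ G) V]
    (hV : IsSimpleModule (MonoidAlgebra ℂ G) V) (hfw : HasFiniteWeight G V) :
    ∃ (H' : Subgroup G) (χ' : H' →* ℂˣ),
      weightSpace H' χ' V ≠ ⊥ ∧ SchurIrreducible G (IndChar H' χ') := by
  obtain ⟨k, N, hN0, hN1, hNle, hNn, hNc⟩ := hG
  have hN : IsCyclicChain k N := ⟨hN0, hN1, hNle, hNn, hNc⟩
  obtain ⟨H, χ, hne, hfd⟩ := hfw
  obtain ⟨v, -, hv0⟩ := (Submodule.ne_bot_iff _).1 hne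
  rw [weightSpace_eq_weightVectors (fun x : H => extendByZero_of_mem (χ := χ) x.2)] at hne hfd
  obtain ⟨P, K, κ, h⟩ := hN.exists_maximalWeight (groupAction G V) ⟨v, hv0⟩
  obtain ⟨H₁, ψ₁, hH₁, hne₁, hfd₁⟩ :=
    h.exists_finiteDimensional_inf eq_top_of_groupAction_mem hne hfd
  have hfi := h.relIndex_ne_zero_of_finiteDimensional hH₁ hne₁ hfd₁
  obtain ⟨w, hw0, hw⟩ := h.nonzero
  obtain ⟨H', ψ, hKH, hHP, hψ, hneψ, hext⟩ := hN.exists_extension (groupAction G V) _ K P κ rfl hfi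
    h.le h.conj_mem h.conj_eq ((Submodule.ne_bot_iff _).2 ⟨w, hw, hw0⟩)
  obtain ⟨χ', hχ'⟩ := exists_character hneψ
  have hχψ : ∀ x ∈ H', extendByZero χ' x = ψ x := fun x hx => by
    rw [extendByZero_of_mem hx, ← hχ']
  refine ⟨H', χ', by rwa [weightSpace_eq_weightVectors hχ'],
    schurIrreducible_indChar χ' fun g hg hgχ => ?_⟩
  have hgψ : ∀ x ∈ H', g⁻¹ * x * g ∈ H' → ψ (g⁻¹ * x * g) = ψ x := fun x hx hgx => by
    rw [← hχψ x hx, ← hχψ _ hgx, hgχ x hx hgx]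
  have hmem : ∀ x, x ∈ K.comap (MulAut.conj g⁻¹).toMonoidHom ↔ g⁻¹ * x * g ∈ K := fun x => by
    simp [Subgroup.mem_comap]
  refine hext g (h.mem_of_conj g ⟨K ⊓ K.comap (MulAut.conj g⁻¹).toMonoidHom, inf_le_left,
    hN.relIndex_ne_zero_of_pow inf_le_left fun x hx => ?_, fun l hl => ?_⟩) hgψ
  · obtain ⟨n, hn, hnx⟩ := hg x (hKH hx)
    obtain ⟨m, hm, -, hmx⟩ := Subgroup.exists_pow_mem_of_relIndex_ne_zero hfi (hHP hnx)
    refine ⟨n * m, Nat.mul_pos hn hm, pow_mem hx _, (hmem _).2 ?_⟩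
    have e : g⁻¹ * x ^ (n * m) * g = (g⁻¹ * x ^ n * g) ^ m := by
      have := conj_pow (i := m) (a := g⁻¹) (b := x ^ n)
      rw [inv_inv] at this
      rw [this, pow_mul]
    rw [e]
    exact hmx.1
  · obtain ⟨hlK, hl⟩ := Subgroup.mem_inf.1 hl
    rw [hmem] at hl
    exact ⟨hl, by rw [← hψ _ hl, ← hψ l hlK, hgψ l (hKH hlK) (hKH hl)]⟩
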